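/- arXiv:2410.21460 — 5 statements merged into one kernel-verified Lean document; each statement's English description precedes it below -/
import Mathlib

section
/- Let f be a homeomorphism of ℝ². Then f ∈ Homeo¹(ℝ²) if and only if the following three conditions hold: (a) f maps every C¹ curve to a C¹ curve; (b) for every p ∈ ℝ², f induces a homeomorphism φ_p of projective tangent spaces at p; and (c) for every pair (p, ℓ) and every transverse sequence (pₙ, kₙ) for (p, ℓ), the sequence ((f(pₙ), φ_{pₙ}(kₙ))) is a transverse sequence, where φ_q are the induced maps from (b). (This is the plane case of the paper's Main Theorem.) -/
open Filter Topology

noncomputable section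

abbrev Plane : Type := ℝ × ℝ

abbrev ProjLine : Type := Projectivization ℝ Plane

instance : TopologicalSpace ProjLine := instTopologicalSpaceQuotient

/-- A regular (C¹, 1-periodic, injective on `[0,1)`, nowhere-vanishing derivative)
parameterization of a simple closed C¹ curve. -/
def IsRegParam (γ : ℝ → Plane) : Prop :=
  ContDiff ℝ 1 γ ∧ Function.Periodic γ 1 ∧ Set.InjOn γ (Set.Ico 0 1) ∧ ∀ t, deriv γ t ≠ 0

/-- `Γ` is a simple closed C¹ curve. -/
def IsC1Curve (Γ : Set Plane) : Prop := ∃ γ : ℝ → Plane, IsRegParam γ ∧ Γ = Set.range γ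

/-- `Γ` is a simple closed C¹ curve through `p` with tangent line `ℓ` at `p`. -/
def TangentAt (Γ : Set Plane) (p : Plane) (ℓ : ProjLine) : Prop :=
  ∃ (γ : ℝ → Plane) (t₀ : ℝ) (h : IsRegParam γ),
    Γ = Set.range γ ∧ γ t₀ = p ∧ ℓ = Projectivization.mk ℝ (deriv γ t₀) (h.2.2.2 t₀)

/-- `f` maps every simple closed C¹ curve to a simple closed C¹ curve. -/
def MapsC1 (f : Plane → Plane) : Prop := ∀ Γ : Set Plane, IsC1Curve Γ → IsC1Curve (f '' Γ)

/-- Membership in `Homeo¹(ℝ²)`. -/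
def InHomeo1 (f : Plane ≃ₜ Plane) : Prop := MapsC1 ⇑f ∧ MapsC1 ⇑f.symm

/-- `φ` is a homeomorphism of projective tangent spaces induced by `f` at `p`. -/
def InducesAt (f : Plane → Plane) (p : Plane) (φ : ProjLine ≃ₜ ProjLine) : Prop :=
  ∀ (Γ : Set Plane) (ℓ : ProjLine), TangentAt Γ p ℓ →
    IsC1Curve (f '' Γ) ∧ TangentAt (f '' Γ) (f p) (φ ℓ)

/-- The secant direction from `q` to `x` (junk value if `x = q`). -/
def secantDir (q x : Plane) : ProjLine :=
  if h : x = q then Projectivization.mk ℝ (1, 0) (by simp) else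
    Projectivization.mk ℝ (x - q) (sub_ne_zero.mpr h)

/-- The sequence `x` converges along the line `ℓ` to `p`. -/
def ConvAlong (p : Plane) (ℓ : ProjLine) (x : ℕ → Plane) : Prop :=
  (∀ n, x n ≠ p) ∧ Tendsto x atTop (𝓝 p) ∧
    Tendsto (fun n => secantDir p (x n)) atTop (𝓝 ℓ)

/-- `(x, k)` is a transverse sequence for `(p, ℓ)`. -/
def TransverseFor (p : Plane) (ℓ : ProjLine) (x : ℕ → Plane) (k : ℕ → ProjLine) : Prop :=
  ConvAlong p ℓ x ∧
    ∀ φ : ℕ → ℕ, StrictMono φ →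
      ¬ Tendsto (fun n => (x (φ n), k (φ n))) atTop (𝓝 (p, ℓ))

/-- `(x, k)` is a transverse sequence. -/
def Transverse (x : ℕ → Plane) (k : ℕ → ProjLine) : Prop := ∃ p ℓ, TransverseFor p ℓ x k

/-- A `C¹` bump on `ℝ` equal to `1` near `0` and supported in `(-1/3, 1/3)`, together with
a bound on its derivative. -/
theorem exists_unit_bump : ∃ (ψ ψ' : ℝ → ℝ) (C : ℝ), Continuous ψ' ∧ (∀ u, HasDerivAt ψ (ψ' u) u) ∧
    ψ 0 = 1 ∧ ψ' 0 = 0 ∧ (∀ u, 1 / 2 ≤ |u| → ψ u = 0 ∧ ψ' u = 0) ∧ (∀ u, |ψ u| ≤ 1) ∧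
    (∀ u, |ψ' u| ≤ C) := by
  let b : ContDiffBump (0 : ℝ) := ⟨1 / 4, 1 / 3, by norm_num, by norm_num⟩
  have hb : ContDiff ℝ 1 (b : ℝ → ℝ) := b.contDiff
  have hd : Continuous (deriv (b : ℝ → ℝ)) := hb.continuous_deriv le_rfl
  obtain ⟨C, hC⟩ := hd.bounded_above_of_compact_support b.hasCompactSupport.deriv
  refine ⟨b, deriv b, C, hd, fun u => (hb.differentiable one_ne_zero u).hasDerivAt, ?_, ?_, ?_, ?_,
    ?_⟩
  · exact b.one_of_mem_closedBall (by simp [b])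
  · rw [b.eventuallyEq_one.deriv_eq]
    simp
  · intro u hu
    have hz : (b : ℝ → ℝ) =ᶠ[𝓝 u] fun _ => 0 := by
      have : ∀ᶠ x in 𝓝 u, 1 / 3 < |x| :=
        continuous_abs.continuousAt.eventually (lt_mem_nhds (by linarith))
      filter_upwards [this] with x hx
      apply b.zero_of_le_dist
      simpa [b] using hx.le
    exact ⟨hz.eq_of_nhds, by rw [hz.deriv_eq]; simp⟩
  · intro u
    rw [abs_of_nonneg b.nonneg]
    exact b.le_one
  · intro u
    simpa using hC u

/-- Hermite interpolation by a `C¹` function along a rapidly decreasing sequence of nodes. -/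
theorem exists_interpolation (x Y M : ℕ → ℝ) (hx : ∀ n, 0 < x n) (hx2 : ∀ n, x (n + 1) ≤ x n / 2)
    (hY : ∀ n, |Y n| ≤ (1 / 2) ^ n * x n) (hM : ∀ n, |M n| ≤ (1 / 2) ^ n) :
    ∃ h h' : ℝ → ℝ, Continuous h' ∧ (∀ s, HasDerivAt h (h' s) s) ∧ h 0 = 0 ∧ h' 0 = 0 ∧
      ∀ n, h (x n) = Y n ∧ h' (x n) = M n := by
  obtain ⟨ψ, ψ', C, hψc, hψ, hψ0, hψ'0, hψs, hψ1, hψC⟩ := exists_unit_bump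
  have hC : 0 ≤ C := (abs_nonneg _).trans (hψC 0)
  have hψcont : Continuous ψ := continuous_iff_continuousAt.2 fun u => (hψ u).continuousAt
  let u : ℕ → ℝ → ℝ := fun n s => (s - x n) / x n
  let b : ℕ → ℝ → ℝ := fun n s => (Y n + M n * (s - x n)) * ψ (u n s)
  let b' : ℕ → ℝ → ℝ := fun n s =>
    M n * ψ (u n s) + (Y n + M n * (s - x n)) * (ψ' (u n s) * (1 / x n))
  have hb : ∀ n s, HasDerivAt (b n) (b' n s) s := by
    intro n s
    have h1 : HasDerivAt (fun s => Y n + M n * (s - x n)) (M n) s := by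
      simpa using (((hasDerivAt_id s).sub_const (x n)).const_mul (M n)).const_add (Y n)
    have h2 : HasDerivAt (u n) (1 / x n) s := ((hasDerivAt_id s).sub_const (x n)).div_const (x n)
    exact h1.mul ((hψ _).comp s h2)
  have hb'c : ∀ n, Continuous (b' n) := by
    intro n
    have : Continuous (u n) := by fun_prop
    fun_prop
  have hzero : ∀ n s, 1 / 2 ≤ |u n s| → b n s = 0 ∧ b' n s = 0 := by
    intro n s h
    simp [b, b', hψs _ h]
  have hbound : ∀ n s, ‖b' n s‖ ≤ (1 + 2 * C) * (1 / 2) ^ n := by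
    intro n s
    by_cases h : 1 / 2 ≤ |u n s|
    · rw [(hzero n s h).2, norm_zero]
      positivity
    · push Not at h
      have hs : s - x n = u n s * x n := by
        simp only [u]
        field_simp [(hx n).ne']
      have h1 : |M n * ψ (u n s)| ≤ (1 / 2) ^ n := by
        rw [abs_mul]
        calc |M n| * |ψ (u n s)| ≤ (1 / 2) ^ n * 1 :=
              mul_le_mul (hM n) (hψ1 _) (abs_nonneg _) (by positivity)
          _ = _ := mul_one _
      have h2 : |Y n + M n * (s - x n)| ≤ 2 * ((1 / 2) ^ n * x n) := by
        have h3 : |M n * (s - x n)| ≤ (1 / 2) ^ n * x n := by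
          rw [hs, ← mul_assoc, abs_mul, abs_of_pos (hx n), abs_mul]
          have : |M n| * |u n s| ≤ (1 / 2) ^ n * 1 :=
            mul_le_mul (hM n) (by linarith) (abs_nonneg _) (by positivity)
          nlinarith [hx n]
        linarith [abs_add_le (Y n) (M n * (s - x n)), hY n]
      have h4 : |ψ' (u n s) * (1 / x n)| ≤ C * (1 / x n) := by
        rw [abs_mul, abs_of_pos (one_div_pos.2 (hx n))]
        exact mul_le_mul_of_nonneg_right (hψC _) (one_div_pos.2 (hx n)).le
      have h5 : |(Y n + M n * (s - x n)) * (ψ' (u n s) * (1 / x n))| ≤ 2 * C * (1 / 2) ^ n := by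
        rw [abs_mul]
        calc _ ≤ 2 * ((1 / 2) ^ n * x n) * (C * (1 / x n)) :=
              mul_le_mul h2 h4 (abs_nonneg _) (by have := hx n; positivity)
          _ = _ := by field_simp [(hx n).ne']
      calc ‖b' n s‖ ≤ |M n * ψ (u n s)| + |(Y n + M n * (s - x n)) * (ψ' (u n s) * (1 / x n))| :=
            abs_add_le _ _
        _ ≤ _ := by linarith
  have hsum : Summable fun n : ℕ => (1 + 2 * C) * (1 / 2 : ℝ) ^ n :=
    (summable_geometric_two).mul_left _
  have hle : ∀ m n, m < n → x n ≤ x m / 2 := by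
    intro m n hmn
    induction n, hmn using Nat.le_induction with
    | base => exact hx2 m
    | succ k _ ih => linarith [hx2 k, hx k]
  have hu0 : ∀ n, 1 / 2 ≤ |u n 0| := by
    intro n
    have : u n 0 = -1 := by
      simp only [u]
      field_simp [(hx n).ne']
      ring
    rw [this]
    norm_num
  have hun : ∀ n m, m ≠ n → 1 / 2 ≤ |u m (x n)| := by
    intro n m hmn
    simp only [u]
    rw [abs_div, abs_of_pos (hx m), le_div_iff₀ (hx m)]
    rcases lt_or_gt_of_ne hmn with h | h
    · have := hle m n h
      exact le_abs.2 (Or.inr (by linarith))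
    · have := hle n m h
      have := hx m
      exact le_abs.2 (Or.inl (by linarith))
  refine ⟨fun s => ∑' n, b n s, fun s => ∑' n, b' n s, continuous_tsum hb'c hsum hbound,
    fun s => hasDerivAt_tsum (y₀ := 0) hsum hb hbound ?_ s, ?_, ?_, fun n => ⟨?_, ?_⟩⟩
  · simp [fun n => (hzero n 0 (hu0 n)).1]
  · simp [fun n => (hzero n 0 (hu0 n)).1]
  · simp [fun n => (hzero n 0 (hu0 n)).2]
  · dsimp only
    rw [tsum_eq_single n fun m hm => (hzero m _ (hun n m hm)).1]
    simp [b, u, hψ0]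
  · dsimp only
    rw [tsum_eq_single n fun m hm => (hzero m _ (hun n m hm)).2]
    simp [b', u, hψ0, hψ'0]

/-- The scalar product on the plane. -/
def dotP (v w : Plane) : ℝ := v.1 * w.1 + v.2 * w.2

/-- The determinant of two plane vectors. -/
def crossP (v w : Plane) : ℝ := v.1 * w.2 - v.2 * w.1

/-- Rotation by a quarter turn. -/
def rotP (v : Plane) : Plane := (-v.2, v.1)

theorem dotP_self_pos {v : Plane} (hv : v ≠ 0) : 0 < dotP v v := by
  have : v.1 ≠ 0 ∨ v.2 ≠ 0 := by
    by_contra! h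
    exact hv (Prod.ext h.1 h.2)
  unfold dotP
  rcases this with h | h
  · nlinarith [mul_self_pos.2 h, mul_self_nonneg v.2]
  · nlinarith [mul_self_pos.2 h, mul_self_nonneg v.1]

theorem dotP_smul_eq (v w : Plane) : dotP v v • w = dotP v w • v + crossP v w • rotP v := by
  ext <;> simp [dotP, crossP, rotP] <;> ring

/-- The circle tangent to `v` at `p`, sheared by `h`. -/
def shearedCircle (p v : Plane) (h : ℝ → ℝ) (t : ℝ) : Plane :=
  p + (Real.sin (2 * Real.pi * t) • v +
    (1 - Real.cos (2 * Real.pi * t) + h (Real.sin (2 * Real.pi * t))) • rotP v)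

theorem hasDerivAt_shearedCircle (p v : Plane) {h h' : ℝ → ℝ} (hh : ∀ s, HasDerivAt h (h' s) s)
    (t : ℝ) : HasDerivAt (shearedCircle p v h)
      ((2 * Real.pi * Real.cos (2 * Real.pi * t)) • v +
        (2 * Real.pi * (Real.sin (2 * Real.pi * t) +
          h' (Real.sin (2 * Real.pi * t)) * Real.cos (2 * Real.pi * t))) • rotP v) t := by
  have h0 : HasDerivAt (fun t : ℝ => 2 * Real.pi * t) (2 * Real.pi) t := by
    simpa using (hasDerivAt_id t).const_mul (2 * Real.pi)
  have h1 := h0.sin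
  have h2 := h0.cos
  have h3 := (hh _).comp t h1
  refine (((h1.smul_const v).add
    (((h2.const_sub 1).add h3).smul_const (rotP v))).const_add p).congr_deriv ?_
  congr 2 <;> ring

theorem isRegParam_shearedCircle (p : Plane) {v : Plane} (hv : v ≠ 0) {h h' : ℝ → ℝ}
    (hc : Continuous h') (hh : ∀ s, HasDerivAt h (h' s) s) : IsRegParam (shearedCircle p v h) := by
  have hd := hasDerivAt_shearedCircle p v hh
  have hN := (dotP_self_pos hv).ne'
  have lin : ∀ a b c d : ℝ, a • v + b • rotP v = c • v + d • rotP v → a = c ∧ b = d := by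
    intro a b c d e
    have e1 := congrArg (dotP v) e
    have e2 := congrArg (crossP v) e
    simp only [dotP, crossP, rotP, Prod.fst_add, Prod.snd_add, Prod.smul_fst, Prod.smul_snd,
      smul_eq_mul] at e1 e2 hN
    constructor
    · apply mul_right_cancel₀ hN
      linarith
    · apply mul_right_cancel₀ hN
      linarith
  refine ⟨?_, ?_, ?_, ?_⟩
  · rw [contDiff_one_iff_deriv]
    refine ⟨fun t => (hd t).differentiableAt, ?_⟩
    rw [funext fun t => (hd t).deriv]
    fun_prop
  · intro t
    simp only [shearedCircle]
    rw [mul_add, mul_one, Real.sin_add_two_pi, Real.cos_add_two_pi]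
  · intro s hs t ht e
    simp only [shearedCircle, add_right_inj] at e
    obtain ⟨e1, e2⟩ := lin _ _ _ _ e
    rw [e1] at e2
    have e3 : Real.cos (2 * Real.pi * s) = Real.cos (2 * Real.pi * t) := by linarith
    have := Real.Angle.cos_sin_inj e3 e1
    rw [Real.Angle.angle_eq_iff_two_pi_dvd_sub] at this
    obtain ⟨k, hk⟩ := this
    have hk' : s - t = k := by
      have : 2 * Real.pi * (s - t - k) = 0 := by linarith
      rcases mul_eq_zero.1 this with h | h
      · exact absurd h (by positivity)
      · linarith
    have h1 : (k : ℝ) < 1 := by linarith [hs.2, ht.1]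
    have h2 : (-1 : ℝ) < k := by linarith [ht.2, hs.1]
    have : k = 0 := by
      have h1' : k < 1 := by exact_mod_cast h1
      have h2' : -1 < k := by exact_mod_cast h2
      lia
    simp [this] at hk'
    linarith
  · intro t e
    rw [(hd t).deriv] at e
    obtain ⟨e1, e2⟩ := lin _ _ 0 0 (by simpa using e)
    have e3 : Real.cos (2 * Real.pi * t) = 0 := by
      rcases mul_eq_zero.1 e1 with h | h
      · exact absurd h (by positivity)
      · exact h
    have e4 : Real.sin (2 * Real.pi * t) = 0 := by
      rcases mul_eq_zero.1 e2 with h | h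
      · exact absurd h (by positivity)
      · simpa [e3] using h
    have := Real.sin_sq_add_cos_sq (2 * Real.pi * t)
    simp [e3, e4] at this

theorem continuous_dotP (v : Plane) : Continuous (dotP v) := by
  unfold dotP
  fun_prop

theorem continuous_crossP (v : Plane) : Continuous (crossP v) := by
  unfold crossP
  fun_prop

theorem dotP_smul (v w : Plane) (c : ℝ) : dotP v (c • w) = c * dotP v w := by
  simp [dotP]
  ring

theorem crossP_smul (v w : Plane) (c : ℝ) : crossP v (c • w) = c * crossP v w := by
  simp [crossP]
  ring

theorem crossP_self (v : Plane) : crossP v v = 0 := by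
  simp [crossP]
  ring

theorem dotP_sq_add_crossP_sq (v w : Plane) :
    dotP v w ^ 2 + crossP v w ^ 2 = dotP v v * dotP w w := by
  simp only [dotP, crossP]
  ring

theorem smul_eq_add_rotP {v w : Plane} (h : dotP v w ≠ 0) :
    (dotP v v / dotP v w) • w = v + (crossP v w / dotP v w) • rotP v := by
  have e : (dotP v v / dotP v w) • w = (dotP v w)⁻¹ • dotP v v • w := by
    rw [smul_smul, div_eq_inv_mul]
  rw [e, dotP_smul_eq, smul_add, smul_smul, smul_smul, inv_mul_cancel₀ h, one_smul,
    div_eq_inv_mul]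

theorem mk_eq_mk_of_crossP {v w : Plane} (hv : v ≠ 0) (hw : w ≠ 0) (h : crossP v w = 0) :
    Projectivization.mk ℝ w hw = Projectivization.mk ℝ v hv := by
  rw [Projectivization.mk_eq_mk_iff']
  refine ⟨dotP v w / dotP v v, ?_⟩
  have := dotP_smul_eq v w
  rw [h, zero_smul, add_zero] at this
  rw [div_eq_inv_mul, mul_smul, ← this, smul_smul, inv_mul_cancel₀ (dotP_self_pos hv).ne', one_smul]

/-- The squared sine of the angle between `v` and a line. -/
def sinSq (v : Plane) : ProjLine → ℝ :=
  Projectivization.lift (fun w => crossP v w ^ 2 / (dotP v v * dotP w w)) (by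
    rintro ⟨a, ha⟩ ⟨b, hb⟩ t h
    have hN := (dotP_self_pos ha).ne'
    simp only at h
    subst h
    have ht : t ≠ 0 := by
      rintro rfl
      simp at ha
    have : dotP (t • b) (t • b) = t ^ 2 * dotP b b := by
      simp [dotP]
      ring
    simp only [crossP_smul, this]
    rw [mul_pow, mul_left_comm, mul_div_mul_left _ _ (pow_ne_zero 2 ht)])

theorem sinSq_mk (v w : Plane) (hw : w ≠ 0) :
    sinSq v (Projectivization.mk ℝ w hw) = crossP v w ^ 2 / (dotP v v * dotP w w) := rfl

theorem continuous_projectivization_mk :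
    Continuous fun w : {w : Plane // w ≠ 0} => Projectivization.mk ℝ w.1 w.2 :=
  continuous_quotient_mk'

theorem continuous_sinSq {v : Plane} (hv : v ≠ 0) : Continuous (sinSq v) := by
  refine Continuous.quotient_lift ?_ _
  have hd : Continuous fun w : {w : Plane // w ≠ 0} => dotP w.1 w.1 := by
    unfold dotP
    fun_prop
  refine (((continuous_crossP v).comp continuous_subtype_val).pow 2).div
    (hd.const_mul _) fun w => ?_
  exact (mul_pos (dotP_self_pos hv) (dotP_self_pos w.2)).ne'

theorem sinSq_eq_zero {v : Plane} (hv : v ≠ 0) {k : ProjLine} (h : sinSq v k = 0) :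
    k = Projectivization.mk ℝ v hv := by
  induction k using Projectivization.ind with
  | h w hw =>
    rw [sinSq_mk, div_eq_zero_iff] at h
    rcases h with h | h
    · exact mk_eq_mk_of_crossP hv hw (by simpa using h)
    · exact absurd h (mul_pos (dotP_self_pos hv) (dotP_self_pos hw)).ne'

theorem sinSq_self {v : Plane} (hv : v ≠ 0) : sinSq v (Projectivization.mk ℝ v hv) = 0 := by
  simp [sinSq_mk, crossP_self]

instance : CompactSpace ProjLine := by
  let g : Metric.sphere (0 : Plane) 1 → ProjLine := fun w =>
    Projectivization.mk ℝ w.1 (ne_zero_of_mem_unit_sphere w)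
  have hg : Continuous g :=
    continuous_projectivization_mk.comp
      (continuous_subtype_val.subtype_mk fun w => ne_zero_of_mem_unit_sphere w)
  have hs : Function.Surjective g := by
    intro k
    induction k using Projectivization.ind with
    | h w hw =>
      refine ⟨⟨‖w‖⁻¹ • w, by simp [norm_smul, hw]⟩, ?_⟩
      simp only [g]
      rw [Projectivization.mk_eq_mk_iff']
      exact ⟨‖w‖⁻¹, rfl⟩
  exact hs.compactSpace hg

instance : T2Space ProjLine := by
  refine ⟨fun k l hkl => ?_⟩
  induction k using Projectivization.ind with
  | h v hv =>
    refine separated_by_continuous (continuous_sinSq hv) ?_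
    rw [sinSq_self]
    exact fun h => hkl (sinSq_eq_zero hv h.symm).symm

theorem nhds_mk {v : Plane} (hv : v ≠ 0) :
    𝓝 (Projectivization.mk ℝ v hv) = comap (sinSq v) (𝓝 0) := by
  apply le_antisymm
  · rw [← tendsto_iff_comap]
    simpa [sinSq_self] using (continuous_sinSq hv).tendsto (Projectivization.mk ℝ v hv)
  · intro U hU
    obtain ⟨V, hVU, hVo, hV⟩ := mem_nhds_iff.1 hU
    have hK : IsClosed (sinSq v '' Vᶜ) :=
      (hVo.isClosed_compl.isCompact.image (continuous_sinSq hv)).isClosed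
    refine ⟨(sinSq v '' Vᶜ)ᶜ, hK.isOpen_compl.mem_nhds ?_, ?_⟩
    · rintro ⟨k, hk, h0⟩
      exact hk (sinSq_eq_zero hv h0 ▸ hV)
    · intro k hk
      by_contra hkU
      exact hk ⟨k, fun h => hkU (hVU h), rfl⟩

theorem tendsto_mk_iff {ι : Type*} {l : Filter ι} {k : ι → ProjLine} {v : Plane} (hv : v ≠ 0) :
    Tendsto k l (𝓝 (Projectivization.mk ℝ v hv)) ↔ Tendsto (fun i => sinSq v (k i)) l (𝓝 0) := by
  rw [nhds_mk, tendsto_comap_iff]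
  rfl

/-- Convergent families of lines have convergent representatives. -/
theorem exists_tendsto_rep {ι : Type*} {l : Filter ι} {k : ι → ProjLine} {v : Plane} (hv : v ≠ 0)
    (hk : Tendsto k l (𝓝 (Projectivization.mk ℝ v hv))) :
    ∃ w : ι → Plane, Tendsto w l (𝓝 v) ∧ ∀ᶠ i in l,
      ∃ h : w i ≠ 0, k i = Projectivization.mk ℝ (w i) h := by
  have hN := dotP_self_pos hv
  rw [tendsto_mk_iff] at hk
  let c : ι → ℝ := fun i => crossP v (k i).rep
  let d : ι → ℝ := fun i => dotP v (k i).rep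
  have hs : ∀ i, sinSq v (k i) = c i ^ 2 / (d i ^ 2 + c i ^ 2) := by
    intro i
    rw [dotP_sq_add_crossP_sq, ← sinSq_mk v _ (k i).rep_nonzero, Projectivization.mk_rep]
  have hpos : ∀ i, 0 < d i ^ 2 + c i ^ 2 := by
    intro i
    rw [dotP_sq_add_crossP_sq]
    exact mul_pos hN (dotP_self_pos (k i).rep_nonzero)
  have hd : ∀ᶠ i in l, d i ≠ 0 := by
    filter_upwards [hk.eventually (gt_mem_nhds one_pos)] with i hi h0
    have := hpos i
    rw [hs, h0] at hi
    rw [h0] at this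
    rw [zero_pow two_ne_zero, zero_add] at hi this
    rw [div_self this.ne'] at hi
    exact lt_irrefl _ hi
  have hcd : Tendsto (fun i => c i / d i) l (𝓝 0) := by
    have h1 : Tendsto (fun i => Real.sqrt (sinSq v (k i) / (1 - sinSq v (k i)))) l (𝓝 0) := by
      have : Tendsto (fun i => sinSq v (k i) / (1 - sinSq v (k i))) l (𝓝 (0 / (1 - 0))) :=
        hk.div (hk.const_sub 1) (by norm_num)
      simpa using this.sqrt
    rw [tendsto_zero_iff_abs_tendsto_zero]
    refine h1.congr' ?_
    filter_upwards [hd] with i hi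
    have := hpos i
    have e : sinSq v (k i) / (1 - sinSq v (k i)) = (c i / d i) ^ 2 := by
      rw [hs]
      have : 1 - c i ^ 2 / (d i ^ 2 + c i ^ 2) = d i ^ 2 / (d i ^ 2 + c i ^ 2) := by
        field_simp
        ring
      rw [this]
      field_simp
    rw [e, Real.sqrt_sq_eq_abs]
    rfl
  refine ⟨fun i => v + (c i / d i) • rotP v, ?_, ?_⟩
  · simpa using (hcd.smul_const (rotP v)).const_add v
  · filter_upwards [hd] with i hi
    have e : v + (c i / d i) • rotP v = (dotP v v / d i) • (k i).rep := by
      exact (smul_eq_add_rotP hi).symm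
    have hne : v + (c i / d i) • rotP v ≠ 0 := by
      rw [e]
      exact smul_ne_zero (div_ne_zero hN.ne' hi) (k i).rep_nonzero
    refine ⟨hne, ?_⟩
    conv_lhs => rw [← (k i).mk_rep]
    symm
    rw [Projectivization.mk_eq_mk_iff']
    exact ⟨_, e.symm⟩

/-- The filter of points approaching `p` along the ray spanned by `v`. -/
def rayFilter (p v : Plane) : Filter Plane :=
  𝓝 p ⊓ comap (fun q => crossP v (q - p) / dotP v (q - p)) (𝓝 0) ⊓ 𝓟 {q | 0 < dotP v (q - p)}

instance (p v : Plane) : (rayFilter p v).IsCountablyGenerated := by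
  unfold rayFilter
  infer_instance

/-- The filter of points approaching `p` along the line `l`. -/
def lineFilter (p : Plane) (l : ProjLine) : Filter Plane :=
  𝓝[≠] p ⊓ comap (secantDir p) (𝓝 l)

theorem secantDir_of_ne {p q : Plane} (h : q ≠ p) :
    secantDir p q = Projectivization.mk ℝ (q - p) (sub_ne_zero.2 h) :=
  dif_neg h

theorem tendsto_rayFilter {ι : Type*} {l : Filter ι} {x : ι → Plane} {p v : Plane} :
    Tendsto x l (rayFilter p v) ↔ Tendsto x l (𝓝 p) ∧
      Tendsto (fun i => crossP v (x i - p) / dotP v (x i - p)) l (𝓝 0) ∧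
      ∀ᶠ i in l, 0 < dotP v (x i - p) := by
  rw [rayFilter, tendsto_inf, tendsto_inf, tendsto_comap_iff, tendsto_principal, and_assoc]
  rfl

theorem tendsto_lineFilter {ι : Type*} {l : Filter ι} {x : ι → Plane} {p : Plane} {k : ProjLine} :
    Tendsto x l (lineFilter p k) ↔ Tendsto x l (𝓝 p) ∧ (∀ᶠ i in l, x i ≠ p) ∧
      Tendsto (fun i => secantDir p (x i)) l (𝓝 k) := by
  rw [lineFilter, tendsto_inf, tendsto_comap_iff, tendsto_nhdsWithin_iff, and_assoc]
  rfl

theorem tendsto_rayFilter_of_smul {ι : Type*} {l : Filter ι} {x : ι → Plane} {p v : Plane}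
    (hv : v ≠ 0) (c : ι → ℝ) (hc : ∀ᶠ i in l, 0 < c i) (hx : Tendsto x l (𝓝 p))
    (h : Tendsto (fun i => c i • (x i - p)) l (𝓝 v)) : Tendsto x l (rayFilter p v) := by
  have h1 := ((continuous_dotP v).tendsto v).comp h
  have h2 := ((continuous_crossP v).tendsto v).comp h
  rw [crossP_self] at h2
  refine tendsto_rayFilter.2 ⟨hx, ?_, ?_⟩
  · have h3 := h2.div h1 (dotP_self_pos hv).ne'
    rw [zero_div] at h3
    refine h3.congr' ?_
    filter_upwards [hc] with i hi
    simp only [Pi.div_apply, Function.comp_apply, dotP_smul, crossP_smul]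
    rw [mul_div_mul_left _ _ hi.ne']
  · filter_upwards [hc, h1.eventually (lt_mem_nhds (dotP_self_pos hv))] with i hi hi'
    simp only [Function.comp_apply, dotP_smul] at hi'
    exact pos_of_mul_pos_right hi' hi.le

theorem exists_smul_of_tendsto_rayFilter {ι : Type*} {l : Filter ι} {x : ι → Plane} {p v : Plane}
    (hv : v ≠ 0) (h : Tendsto x l (rayFilter p v)) :
    ∃ c : ι → ℝ, (∀ᶠ i in l, 0 < c i) ∧ Tendsto (fun i => c i • (x i - p)) l (𝓝 v) := by
  obtain ⟨-, h2, h3⟩ := tendsto_rayFilter.1 h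
  have hN := dotP_self_pos hv
  refine ⟨fun i => dotP v v / dotP v (x i - p), ?_, ?_⟩
  · filter_upwards [h3] with i hi
    positivity
  · have h4 := (h2.smul_const (rotP v)).const_add v
    rw [zero_smul, add_zero] at h4
    refine h4.congr' ?_
    filter_upwards [h3] with i hi
    exact (smul_eq_add_rotP hi.ne').symm

theorem rayFilter_smul (p : Plane) {v : Plane} (hv : v ≠ 0) {c : ℝ} (hc : 0 < c) :
    rayFilter p (c • v) = rayFilter p v := by
  have key : ∀ {v : Plane}, v ≠ 0 → ∀ {c : ℝ}, 0 < c → rayFilter p v ≤ rayFilter p (c • v) := by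
    intro v hv c hc
    have h : Tendsto id (rayFilter p v) (rayFilter p v) := tendsto_id
    obtain ⟨a, ha, hav⟩ := exists_smul_of_tendsto_rayFilter hv h
    refine tendsto_id'.1 (tendsto_rayFilter_of_smul (smul_ne_zero hc.ne' hv) (fun q => c * a q) ?_
      (tendsto_rayFilter.1 h).1 ?_)
    · filter_upwards [ha] with q hq
      positivity
    · simpa [mul_smul] using hav.const_smul c
  refine le_antisymm ?_ (key hv hc)
  have := key (smul_ne_zero hc.ne' hv) (inv_pos.2 hc)
  rwa [smul_smul, inv_mul_cancel₀ hc.ne', one_smul] at this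

theorem eventually_dotP_pos {ι : Type*} {l : Filter ι} {x : ι → Plane} {p v m : Plane} (hv : v ≠ 0)
    (h : Tendsto x l (rayFilter p v)) (hm : 0 < dotP m v) : ∀ᶠ i in l, 0 < dotP m (x i - p) := by
  obtain ⟨c, hc, hcv⟩ := exists_smul_of_tendsto_rayFilter hv h
  filter_upwards [hc, (((continuous_dotP m).tendsto v).comp hcv).eventually (lt_mem_nhds hm)]
    with i hi hi'
  simp only [Function.comp_apply, dotP_smul] at hi'
  exact pos_of_mul_pos_right hi' hi.le

theorem ray_unique {ι : Type*} {l : Filter ι} [l.NeBot] {x : ι → Plane} {p v v' : Plane}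
    (hv : v ≠ 0) (hv' : v' ≠ 0) (h : Tendsto x l (rayFilter p v))
    (h' : Tendsto x l (rayFilter p v')) : ∃ c : ℝ, 0 < c ∧ v' = c • v := by
  obtain ⟨a, ha, hav⟩ := exists_smul_of_tendsto_rayFilter hv h
  obtain ⟨-, h2, h3⟩ := tendsto_rayFilter.1 h'
  have hd := ((continuous_dotP v').tendsto v).comp hav
  have hc := ((continuous_crossP v').tendsto v).comp hav
  have h0 : crossP v' v = 0 := by
    refine tendsto_nhds_unique hc ?_
    have := h2.mul hd
    rw [zero_mul] at this
    refine this.congr' ?_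
    filter_upwards [h3] with i hi
    simp only [Function.comp_apply, dotP_smul, crossP_smul]
    field_simp
  have h1 : 0 ≤ dotP v' v := by
    refine ge_of_tendsto hd ?_
    filter_upwards [h3, ha] with i hi hi'
    simp only [Function.comp_apply, dotP_smul]
    positivity
  have e := dotP_smul_eq v' v
  rw [h0, zero_smul, add_zero] at e
  have h2 : dotP v' v ≠ 0 := by
    intro h
    rw [h, zero_smul] at e
    exact smul_ne_zero (dotP_self_pos hv').ne' hv e
  refine ⟨dotP v' v' / dotP v' v, div_pos (dotP_self_pos hv') (h1.lt_of_ne' h2), ?_⟩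
  rw [div_eq_inv_mul, mul_smul, e, smul_smul, inv_mul_cancel₀ h2, one_smul]

theorem rayFilter_eq_of_tendsto {ι : Type*} {l : Filter ι} [l.NeBot] {x : ι → Plane}
    {p v v' : Plane} (hv : v ≠ 0) (hv' : v' ≠ 0) (h : Tendsto x l (rayFilter p v))
    (h' : Tendsto x l (rayFilter p v')) : rayFilter p v' = rayFilter p v := by
  obtain ⟨c, hc, rfl⟩ := ray_unique hv hv' h h'
  exact rayFilter_smul p hv hc

theorem rayFilter_le_nhdsNE (p v : Plane) : rayFilter p v ≤ 𝓝[≠] p := by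
  refine tendsto_id'.1 (tendsto_nhdsWithin_iff.2 ?_)
  obtain ⟨h1, -, h3⟩ :=
    tendsto_rayFilter.1 (tendsto_id : Tendsto id (rayFilter p v) (rayFilter p v))
  refine ⟨h1, h3.mono fun q hq h => ?_⟩
  simp only [id, Set.mem_singleton_iff] at hq h
  simp [h, dotP] at hq

theorem rayFilter_le_lineFilter (p : Plane) {v : Plane} (hv : v ≠ 0) :
    rayFilter p v ≤ lineFilter p (Projectivization.mk ℝ v hv) := by
  refine le_inf (rayFilter_le_nhdsNE p v) (tendsto_iff_comap.1 ((tendsto_mk_iff hv).2 ?_))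
  obtain ⟨h1, h2, h3⟩ :=
    tendsto_rayFilter.1 (tendsto_id : Tendsto id (rayFilter p v) (rayFilter p v))
  have h4 := h2.pow 2
  rw [zero_pow two_ne_zero] at h4
  refine tendsto_of_tendsto_of_tendsto_of_le_of_le' tendsto_const_nhds h4 ?_ ?_
  · filter_upwards [rayFilter_le_nhdsNE p v self_mem_nhdsWithin] with q hq
    rw [secantDir_of_ne hq, sinSq_mk, ← dotP_sq_add_crossP_sq]
    positivity
  · filter_upwards [rayFilter_le_nhdsNE p v self_mem_nhdsWithin, h3] with q hq hq'
    simp only [id] at hq' ⊢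
    rw [secantDir_of_ne hq, sinSq_mk, ← dotP_sq_add_crossP_sq, div_pow]
    gcongr
    nlinarith [sq_nonneg (crossP v (q - p))]

theorem line_unique {ι : Type*} {l : Filter ι} [l.NeBot] {x : ι → Plane} {p : Plane}
    {k k' : ProjLine} (h : Tendsto x l (lineFilter p k)) (h' : Tendsto x l (lineFilter p k')) :
    k = k' :=
  tendsto_nhds_unique (tendsto_lineFilter.1 h).2.2 (tendsto_lineFilter.1 h').2.2

theorem exists_ultrafilter_le_rayFilter {p : Plane} {U : Ultrafilter Plane}
    (hU : (U : Filter Plane) ≤ 𝓝[≠] p) :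
    ∃ v : Plane, v ≠ 0 ∧ (U : Filter Plane) ≤ rayFilter p v := by
  have hne : ∀ᶠ q in (U : Filter Plane), q ≠ p := hU self_mem_nhdsWithin
  let d : Plane → Plane := fun q => ‖q - p‖⁻¹ • (q - p)
  have hS : ∀ᶠ q in (U : Filter Plane), d q ∈ Metric.sphere (0 : Plane) 1 := by
    filter_upwards [hne] with q hq
    simp [d, norm_smul, sub_ne_zero.2 hq]
  obtain ⟨v, hv, hUv⟩ := (isCompact_sphere (0 : Plane) 1).ultrafilter_le_nhds' (U.map d) hS
  have hv0 : v ≠ 0 := ne_zero_of_mem_unit_sphere ⟨v, hv⟩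
  refine ⟨v, hv0, tendsto_id'.1 (tendsto_rayFilter_of_smul hv0 (fun q => ‖q - p‖⁻¹) ?_ ?_ ?_)⟩
  · filter_upwards [hne] with q hq
    have := sub_ne_zero.2 hq
    positivity
  · exact hU.trans nhdsWithin_le_nhds
  · exact hUv

theorem lineFilter_mk (p : Plane) {v : Plane} (hv : v ≠ 0) :
    lineFilter p (Projectivization.mk ℝ v hv) = rayFilter p v ⊔ rayFilter p (-v) := by
  apply le_antisymm
  · refine le_iff_ultrafilter.2 fun U hU => ?_
    obtain ⟨w, hw, hUw⟩ := exists_ultrafilter_le_rayFilter (hU.trans inf_le_left)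
    have e := line_unique (x := id) (hUw.trans (rayFilter_le_lineFilter p hw)) hU
    rw [Projectivization.mk_eq_mk_iff'] at e
    obtain ⟨a, rfl⟩ := e
    rcases lt_trichotomy a 0 with ha | ha | ha
    · rw [show a • v = (-a) • (-v) by simp, rayFilter_smul p (neg_ne_zero.2 hv) (neg_pos.2 ha)]
        at hUw
      exact hUw.trans le_sup_right
    · simp [ha] at hw
    · rw [rayFilter_smul p hv ha] at hUw
      exact hUw.trans le_sup_left
  · refine sup_le (rayFilter_le_lineFilter p hv) ?_
    have h : Projectivization.mk ℝ v hv = Projectivization.mk ℝ (-v) (neg_ne_zero.2 hv) := by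
      rw [Projectivization.mk_eq_mk_iff']
      exact ⟨-1, by simp⟩
    rw [h]
    exact rayFilter_le_lineFilter p _

theorem tendsto_rayFilter_right {γ : ℝ → Plane} {v : Plane} (hv : v ≠ 0) {t : ℝ}
    (h : HasDerivAt γ v t) : Tendsto γ (𝓝[>] t) (rayFilter (γ t) v) := by
  refine tendsto_rayFilter_of_smul hv (fun s => (s - t)⁻¹) ?_
    (h.continuousAt.tendsto.mono_left nhdsWithin_le_nhds) ?_
  · filter_upwards [self_mem_nhdsWithin] with s hs
    exact inv_pos.2 (sub_pos.2 hs)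
  · exact (hasDerivAt_iff_tendsto_slope.1 h).mono_left (nhdsGT_le_nhdsNE t)

theorem tendsto_rayFilter_left {γ : ℝ → Plane} {v : Plane} (hv : v ≠ 0) {t : ℝ}
    (h : HasDerivAt γ v t) : Tendsto γ (𝓝[<] t) (rayFilter (γ t) (-v)) := by
  refine tendsto_rayFilter_of_smul (neg_ne_zero.2 hv) (fun s => -(s - t)⁻¹) ?_
    (h.continuousAt.tendsto.mono_left nhdsWithin_le_nhds) ?_
  · filter_upwards [self_mem_nhdsWithin] with s hs
    rw [neg_pos]
    exact inv_lt_zero.2 (sub_neg.2 hs)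
  · have := ((hasDerivAt_iff_tendsto_slope.1 h).mono_left (nhdsLT_le_nhdsNE t)).neg
    refine this.congr fun s => ?_
    simp [slope]

theorem tendsto_lineFilter_of_hasDerivAt {γ : ℝ → Plane} {v : Plane} (hv : v ≠ 0) {t : ℝ}
    (h : HasDerivAt γ v t) :
    Tendsto γ (𝓝[≠] t) (lineFilter (γ t) (Projectivization.mk ℝ v hv)) := by
  rw [lineFilter_mk, ← nhdsLT_sup_nhdsGT, sup_comm]
  exact (tendsto_rayFilter_right hv h).sup_sup (tendsto_rayFilter_left hv h)

theorem rayFilter_neBot (p : Plane) {v : Plane} (hv : v ≠ 0) : (rayFilter p v).NeBot := by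
  have h : HasDerivAt (fun t : ℝ => p + t • v) v 0 := by
    simpa using ((hasDerivAt_id (0 : ℝ)).smul_const v).const_add p
  have := tendsto_rayFilter_right hv h
  simp only [zero_smul, add_zero] at this
  exact this.neBot

theorem exists_shearedCircle_through (p : Plane) {v : Plane} (hv : v ≠ 0)
    (P : ℕ → Plane × Plane → Prop)
    (hP : ∀ n, ∃ᶠ z in rayFilter p v ×ˢ 𝓝 v, P n z) :
    ∃ γ : ℝ → Plane, IsRegParam γ ∧ γ 0 = p ∧ (∃ c : ℝ, 0 < c ∧ deriv γ 0 = c • v) ∧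
      ∃ (t : ℕ → ℝ) (w : ℕ → Plane), Tendsto t atTop (𝓝[>] 0) ∧
        ∀ n, P n (γ (t n), w n) ∧ ∃ c : ℝ, deriv γ (t n) = c • w n := by
  have hN := dotP_self_pos hv
  let G : Filter (Plane × Plane) := rayFilter p v ×ˢ 𝓝 v
  let N : ℝ := dotP v v
  let x : Plane × Plane → ℝ := fun z => dotP v (z.1 - p) / N
  let y : Plane × Plane → ℝ := fun z => crossP v (z.1 - p) / N
  let m : Plane × Plane → ℝ := fun z => crossP v z.2 / dotP v z.2
  let Y : Plane × Plane → ℝ := fun z => y z - (1 - √(1 - x z ^ 2))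
  let M : Plane × Plane → ℝ := fun z => m z - x z / √(1 - x z ^ 2)
  obtain ⟨hG1, hG2, hG3⟩ := tendsto_rayFilter.1 (tendsto_fst : Tendsto Prod.fst G (rayFilter p v))
  have hw : Tendsto Prod.snd G (𝓝 v) := tendsto_snd
  have hx0 : Tendsto x G (𝓝 0) := by
    have h : Tendsto (fun z : Plane × Plane => dotP v (z.1 - p)) G (𝓝 (dotP v (p - p))) :=
      ((continuous_dotP v).tendsto _).comp (hG1.sub_const p)
    have h0 : dotP v (p - p) = 0 := by simp [dotP]
    have := h.div_const N
    rw [h0, zero_div] at this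
    exact this
  have hm0 : Tendsto m G (𝓝 0) := by
    have := (((continuous_crossP v).tendsto v).comp hw).div
      (((continuous_dotP v).tendsto v).comp hw) hN.ne'
    rw [crossP_self, zero_div] at this
    exact this
  have hM0 : Tendsto M G (𝓝 0) := by
    have h1 : Tendsto (fun z => √(1 - x z ^ 2)) G (𝓝 1) := by
      simpa using ((hx0.pow 2).const_sub 1).sqrt
    simpa using hm0.sub (hx0.div h1 one_ne_zero)
  have hev : ∀ δ > 0, ∀ᶠ z in G, 0 < x z ∧ x z < δ ∧ |Y z| ≤ δ * x z ∧ |M z| ≤ δ ∧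
      0 < dotP v z.2 := by
    intro δ hδ
    have hG2' := hG2.abs
    have hM0' := hM0.abs
    rw [abs_zero] at hG2' hM0'
    filter_upwards [hG3, hx0.eventually (gt_mem_nhds (half_pos hδ)),
      hx0.eventually (gt_mem_nhds one_pos), hG2'.eventually (gt_mem_nhds (half_pos hδ)),
      hM0'.eventually (gt_mem_nhds hδ),
      (((continuous_dotP v).tendsto v).comp hw).eventually (lt_mem_nhds hN)]
      with z h1 h2 h3 h4 h5 h6
    have hxz : 0 < x z := div_pos h1 hN
    refine ⟨hxz, by linarith, ?_, h5.le, h6⟩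
    have hy : |y z| ≤ δ / 2 * x z := by
      have : y z = crossP v (z.1 - p) / dotP v (z.1 - p) * x z := by
        simp only [x, y]
        field_simp
      rw [this, abs_mul, abs_of_pos hxz]
      exact mul_le_mul_of_nonneg_right h4.le hxz.le
    have hs1 : √(1 - x z ^ 2) ≤ 1 := Real.sqrt_le_one.2 (by nlinarith)
    have hx1 : x z ^ 2 ≤ 1 := by nlinarith
    have hs2 : 1 - x z ^ 2 ≤ √(1 - x z ^ 2) :=
      Real.le_sqrt_of_sq_le (by nlinarith [sq_nonneg (x z)])
    have := abs_sub (y z) (1 - √(1 - x z ^ 2))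
    rw [abs_of_nonneg (sub_nonneg.2 hs1)] at this
    calc |Y z| ≤ _ := this
      _ ≤ δ / 2 * x z + x z ^ 2 := by linarith
      _ ≤ δ * x z := by nlinarith
  have hex : ∀ (n : ℕ) (ε : ℝ), ∃ z, 0 < ε → P n z ∧ 0 < x z ∧ x z ≤ ε ∧ x z < 1 ∧
      |Y z| ≤ (1 / 2) ^ n * x z ∧ |M z| ≤ (1 / 2) ^ n ∧ 0 < dotP v z.2 := by
    intro n ε
    by_cases hε : 0 < ε
    · obtain ⟨z, hz, ⟨h1, h2, h3, h4, h5⟩, -, h6, -⟩ := ((hP n).and_eventually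
        ((hev ((1 / 2) ^ n) (by positivity)).and (hev ε hε))).exists
      exact ⟨z, fun _ => ⟨hz, h1, h6.le, h2.trans_le (pow_le_one₀ (by norm_num) (by norm_num)),
        h3, h4, h5⟩⟩
    · exact ⟨0, fun h => absurd h hε⟩
  choose g hg using hex
  let Z : ℕ → Plane × Plane := fun n => Nat.rec (g 0 1) (fun n z => g (n + 1) (x z / 2)) n
  have hZ : ∀ n, P n (Z n) ∧ 0 < x (Z n) ∧ x (Z n) < 1 ∧ |Y (Z n)| ≤ (1 / 2) ^ n * x (Z n) ∧
      |M (Z n)| ≤ (1 / 2) ^ n ∧ 0 < dotP v (Z n).2 := by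
    intro n
    induction n with
    | zero =>
      obtain ⟨h1, h2, -, h⟩ := hg 0 1 one_pos
      exact ⟨h1, h2, h⟩
    | succ n ih =>
      obtain ⟨h1, h2, -, h⟩ := hg (n + 1) (x (Z n) / 2) (half_pos ih.2.1)
      exact ⟨h1, h2, h⟩
  have hZ2 : ∀ n, x (Z (n + 1)) ≤ x (Z n) / 2 := fun n =>
    (hg (n + 1) (x (Z n) / 2) (half_pos (hZ n).2.1)).2.2.1
  obtain ⟨h, h', hc, hh, hh0, hh'0, hhZ⟩ := exists_interpolation (fun n => x (Z n))
    (fun n => Y (Z n)) (fun n => M (Z n)) (fun n => (hZ n).2.1) hZ2 (fun n => (hZ n).2.2.2.1)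
    (fun n => (hZ n).2.2.2.2.1)
  have hxlim : Tendsto (fun n => x (Z n)) atTop (𝓝 0) := by
    have hle : ∀ n, x (Z n) ≤ (1 / 2) ^ n := by
      intro n
      induction n with
      | zero => simpa using (hZ 0).2.2.1.le
      | succ n ih =>
        rw [pow_succ]
        linarith [hZ2 n]
    exact squeeze_zero (fun n => (hZ n).2.1.le) hle
      (tendsto_pow_atTop_nhds_zero_of_lt_one (by norm_num) (by norm_num))
  refine ⟨shearedCircle p v h, isRegParam_shearedCircle p hv hc hh, by simp [shearedCircle, hh0],
    ⟨2 * Real.pi, by positivity, ?_⟩, fun n => Real.arcsin (x (Z n)) / (2 * Real.pi),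
    fun n => (Z n).2, ?_, fun n => ?_⟩
  · rw [(hasDerivAt_shearedCircle p v hh 0).deriv]
    simp [hh'0]
  · rw [tendsto_nhdsWithin_iff]
    constructor
    · have := ((Real.continuous_arcsin.tendsto 0).comp hxlim).div_const (2 * Real.pi)
      simpa using this
    · refine Eventually.of_forall fun n => ?_
      exact div_pos (Real.arcsin_pos.2 (hZ n).2.1) (by positivity)
  · obtain ⟨hz1, hz2, hz3, -, -, hz6⟩ := hZ n
    have e1 : 2 * Real.pi * (Real.arcsin (x (Z n)) / (2 * Real.pi)) = Real.arcsin (x (Z n)) := by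
      field_simp
    have e2 : Real.sin (Real.arcsin (x (Z n))) = x (Z n) :=
      Real.sin_arcsin (by linarith) hz3.le
    have hC : 0 < √(1 - x (Z n) ^ 2) := Real.sqrt_pos.2 (by nlinarith)
    constructor
    · convert hz1 using 1
      ext1
      · have e3 : (Z n).1 - p = x (Z n) • v + y (Z n) • rotP v := by
          rw [← inv_smul_smul₀ hN.ne' ((Z n).1 - p), dotP_smul_eq, smul_add, smul_smul, smul_smul]
          simp only [x, y, N, div_eq_inv_mul]
        simp only [shearedCircle]
        rw [e1, e2, Real.cos_arcsin, (hhZ n).1]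
        simp only [Y]
        rw [add_sub_cancel, ← e3, add_sub_cancel]
      · rfl
    · refine ⟨2 * Real.pi * √(1 - x (Z n) ^ 2) * (N / dotP v (Z n).2), ?_⟩
      rw [(hasDerivAt_shearedCircle p v hh _).deriv, e1, e2, Real.cos_arcsin, (hhZ n).2,
          mul_smul _ (N / _),
        smul_eq_add_rotP hz6.ne', smul_add, smul_smul _ (crossP _ _ / _)]
      congr 2
      simp only [M, m]
      field_simp
      ring

namespace IsRegParam

variable {γ : ℝ → Plane}

theorem hasDerivAt (h : IsRegParam γ) (t : ℝ) : HasDerivAt γ (deriv γ t) t :=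
  (h.1.differentiable one_ne_zero t).hasDerivAt

theorem eq_of_abs_sub_lt_one (h : IsRegParam γ) {s t : ℝ} (hst : γ s = γ t) (hlt : |s - t| < 1) :
    s = t := by
  have hfr : ∀ r, γ (Int.fract r) = γ r := fun r => by
    have := h.2.1.sub_int_mul_eq (x := r) ⌊r⌋
    rwa [mul_one] at this
  have hmem : ∀ r : ℝ, Int.fract r ∈ Set.Ico (0 : ℝ) 1 := fun r =>
    ⟨Int.fract_nonneg r, Int.fract_lt_one r⟩
  have := h.2.2.1 (hmem s) (hmem t) (by rw [hfr, hfr, hst])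
  obtain ⟨z, hz⟩ := Int.fract_eq_fract.1 this
  rw [hz] at hlt
  have hz0 : z = 0 := by
    rw [← Int.abs_lt_one_iff]
    exact_mod_cast hlt
  rw [hz0, Int.cast_zero, sub_eq_zero] at hz
  exact hz

theorem comp_neg (h : IsRegParam γ) : IsRegParam fun t => γ (-t) := by
  refine ⟨h.1.comp contDiff_neg, fun t => ?_, fun s hs t ht hst => ?_, fun t => ?_⟩
  · have := h.2.1.sub_eq (-t)
    simpa [neg_add, sub_eq_add_neg, add_comm] using this
  · have := h.eq_of_abs_sub_lt_one hst (by
      rw [abs_lt]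
      constructor <;> linarith [hs.1, hs.2, ht.1, ht.2])
    simpa using this
  · rw [deriv_comp_neg]
    exact neg_ne_zero.2 (h.2.2.2 _)

theorem range_comp_neg (γ : ℝ → Plane) : Set.range (fun t => γ (-t)) = Set.range γ :=
  (Equiv.neg ℝ).surjective.range_comp γ

theorem nhdsWithin_range_le (h : IsRegParam γ) (t : ℝ) : 𝓝[Set.range γ] (γ t) ≤ map γ (𝓝 t) := by
  intro S hS
  obtain ⟨δ, hδ, hS⟩ := Metric.nhds_basis_closedBall.mem_iff.1 (mem_map.1 hS)
  have hK : IsCompact (γ '' Set.Icc (t + δ) (t - δ + 1)) := isCompact_Icc.image h.1.continuous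
  have hnot : γ t ∉ γ '' Set.Icc (t + δ) (t - δ + 1) := by
    rintro ⟨s, hs, hst⟩
    have := h.eq_of_abs_sub_lt_one hst (by
      rw [abs_lt]
      constructor <;> linarith [hs.1, hs.2])
    linarith [hs.1]
  filter_upwards [self_mem_nhdsWithin,
    mem_nhdsWithin_of_mem_nhds (hK.isClosed.isOpen_compl.mem_nhds hnot)] with q hq hqK
  obtain ⟨s, rfl⟩ := hq
  obtain ⟨r, hr, hrs⟩ := h.2.1.exists_mem_Ico one_pos s (t - δ)
  rw [hrs] at hqK ⊢
  have : r < t + δ := by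
    by_contra hcon
    exact hqK ⟨r, ⟨not_lt.1 hcon, hr.2.le⟩, rfl⟩
  refine hS ?_
  rw [Metric.mem_closedBall, Real.dist_eq, abs_le]
  constructor <;> linarith [hr.1]

theorem nhdsWithin_range_diff_le (h : IsRegParam γ) (t : ℝ) :
    𝓝[Set.range γ \ {γ t}] (γ t) ≤ map γ (𝓝[≠] t) := by
  intro S hS
  rw [mem_map, mem_nhdsWithin_iff_eventually] at hS
  have : {q | q ≠ γ t → q ∈ S} ∈ 𝓝[Set.range γ] (γ t) := by
    refine h.nhdsWithin_range_le t ?_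
    rw [mem_map]
    filter_upwards [hS] with s hs hne
    exact hs fun e => hne (by rw [show s = t from e])
  have hle : 𝓝[Set.range γ \ {γ t}] (γ t) ≤ 𝓝[Set.range γ] (γ t) :=
    nhdsWithin_mono _ Set.sdiff_subset
  filter_upwards [hle this, self_mem_nhdsWithin] with q hq hq'
  exact hq hq'.2

theorem tangentAt (h : IsRegParam γ) (t : ℝ) :
    TangentAt (Set.range γ) (γ t) (Projectivization.mk ℝ (deriv γ t) (h.2.2.2 t)) :=
  ⟨γ, t, h, rfl, rfl, rfl⟩

theorem eventually_ne (h : IsRegParam γ) (t : ℝ) : ∀ᶠ s in 𝓝[≠] t, γ s ≠ γ t := by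
  have : ∀ᶠ s in 𝓝[≠] t, s ∈ Metric.ball t 1 :=
    mem_nhdsWithin_of_mem_nhds (Metric.ball_mem_nhds t one_pos)
  filter_upwards [this, self_mem_nhdsWithin] with s hs hne e
  exact hne (h.eq_of_abs_sub_lt_one e hs)

theorem tendsto_nhdsWithin_range (h : IsRegParam γ) (t : ℝ) :
    Tendsto γ (𝓝[≠] t) (𝓝[Set.range γ \ {γ t}] (γ t)) := by
  rw [tendsto_nhdsWithin_iff]
  refine ⟨h.1.continuous.continuousAt.tendsto.mono_left nhdsWithin_le_nhds, ?_⟩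
  filter_upwards [h.eventually_ne t] with s hs
  exact ⟨⟨s, rfl⟩, hs⟩

theorem continuous_mk_deriv (h : IsRegParam γ) :
    Continuous fun t => Projectivization.mk ℝ (deriv γ t) (h.2.2.2 t) :=
  continuous_projectivization_mk.comp ((h.1.continuous_deriv le_rfl).subtype_mk h.2.2.2)

end IsRegParam

namespace TangentAt

variable {Γ : Set Plane} {p : Plane} {ℓ : ProjLine}

theorem isC1Curve (h : TangentAt Γ p ℓ) : IsC1Curve Γ :=
  let ⟨γ, _, hγ, hΓ, _⟩ := h
  ⟨γ, hγ, hΓ⟩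

theorem mem (h : TangentAt Γ p ℓ) : p ∈ Γ := by
  obtain ⟨γ, t, hγ, rfl, rfl, -⟩ := h
  exact ⟨t, rfl⟩

theorem nhdsWithin_le (h : TangentAt Γ p ℓ) : 𝓝[Γ \ {p}] p ≤ lineFilter p ℓ := by
  obtain ⟨γ, t, hγ, rfl, rfl, rfl⟩ := h
  exact (hγ.nhdsWithin_range_diff_le t).trans
    (tendsto_lineFilter_of_hasDerivAt (hγ.2.2.2 t) (hγ.hasDerivAt t))

theorem nhdsWithin_neBot (h : TangentAt Γ p ℓ) : (𝓝[Γ \ {p}] p).NeBot := by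
  obtain ⟨γ, t, hγ, rfl, rfl, rfl⟩ := h
  exact (hγ.tendsto_nhdsWithin_range t).neBot

theorem unique (h : TangentAt Γ p ℓ) {ℓ' : ProjLine} (h' : TangentAt Γ p ℓ') : ℓ = ℓ' :=
  have := h.nhdsWithin_neBot
  line_unique (x := id) (l := 𝓝[Γ \ {p}] p) h.nhdsWithin_le h'.nhdsWithin_le

theorem eventually_tangentAt (h : TangentAt Γ p ℓ) {U : Set ProjLine} (hU : U ∈ 𝓝 ℓ) :
    ∀ᶠ q in 𝓝[Γ] p, ∀ k, TangentAt Γ q k → k ∈ U := by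
  obtain ⟨γ, t, hγ, rfl, rfl, rfl⟩ := h
  refine hγ.nhdsWithin_range_le t ?_
  rw [mem_map]
  filter_upwards [hγ.continuous_mk_deriv.continuousAt hU] with s hs k hk
  rwa [hk.unique (hγ.tangentAt s)]

end TangentAt

theorem IsC1Curve.exists_tangentAt {Γ : Set Plane} (h : IsC1Curve Γ) {p : Plane} (hp : p ∈ Γ) :
    ∃ ℓ, TangentAt Γ p ℓ := by
  obtain ⟨γ, hγ, rfl⟩ := h
  obtain ⟨t, rfl⟩ := hp
  exact ⟨_, hγ.tangentAt t⟩

/-- A continuous path on a C¹ curve leaving a point immediately does so along one ray. -/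
theorem TangentAt.exists_tendsto_rayFilter {Γ : Set Plane} {c : ℝ → Plane} {t : ℝ} {ℓ : ProjLine}
    (h : TangentAt Γ (c t) ℓ) (hc : Continuous c) (hcΓ : ∀ s, c s ∈ Γ)
    (hne : ∀ᶠ s in 𝓝[>] t, c s ≠ c t) :
    ∃ (u : Plane) (hu : u ≠ 0), ℓ = Projectivization.mk ℝ u hu ∧
      Tendsto c (𝓝[>] t) (rayFilter (c t) u) := by
  induction ℓ using Projectivization.ind with
  | h u hu =>
  have hle : Tendsto c (𝓝[>] t) (rayFilter (c t) u ⊔ rayFilter (c t) (-u)) := by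
    rw [← lineFilter_mk _ hu]
    refine Tendsto.mono_right (tendsto_nhdsWithin_iff.2
      ⟨hc.continuousAt.tendsto.mono_left nhdsWithin_le_nhds, ?_⟩) h.nhdsWithin_le
    filter_upwards [hne] with s hs
    exact ⟨hcΓ s, hs⟩
  have hneg : ∀ q, dotP (-u) q = - dotP u q := fun q => by simp [dotP]; ring
  have hpos : ∀ᶠ q in rayFilter (c t) u, 0 < dotP u (q - c t) := 
    mem_inf_of_right (mem_principal_self _)
  have hneg' : ∀ᶠ q in rayFilter (c t) (-u), dotP u (q - c t) < 0 := by
    have : ∀ᶠ q in rayFilter (c t) (-u), 0 < dotP (-u) (q - c t) := 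
    mem_inf_of_right (mem_principal_self _)
    filter_upwards [this] with q hq
    rw [hneg] at hq
    linarith
  have hnz : ∀ᶠ s in 𝓝[>] t, dotP u (c s - c t) ≠ 0 :=
    hle.eventually (eventually_sup.2 ⟨hpos.mono fun q h => h.ne', hneg'.mono fun q h => h.ne⟩)
  obtain ⟨b, hb, hbI⟩ := (mem_nhdsGT_iff_exists_Ioo_subset).1 hnz
  have hcont : ContinuousOn (fun s => dotP u (c s - c t)) (Set.Ioo t b) :=
    ((continuous_dotP u).comp (hc.sub continuous_const)).continuousOn
  have hmem : Set.Ioo t b ∈ 𝓝[>] t := Ioo_mem_nhdsGT hb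
  by_cases hsign : ∃ s ∈ Set.Ioo t b, 0 < dotP u (c s - c t)
  · obtain ⟨s, hs, hs0⟩ := hsign
    refine ⟨u, hu, rfl, ?_⟩
    have hev : ∀ᶠ r in 𝓝[>] t, c r ∈ {q | 0 < dotP u (q - c t)} := by
      filter_upwards [hmem] with r hr
      by_contra hcon
      obtain ⟨z, hz, hz0⟩ := (isPreconnected_Ioo.intermediate_value hr hs hcont)
        ⟨not_lt.1 hcon, hs0.le⟩
      exact hbI hz hz0
    have := tendsto_inf.2 ⟨hle, tendsto_principal.2 hev⟩
    refine this.mono_right ?_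
    rw [inf_sup_right]
    refine sup_le inf_le_left ?_
    rw [inf_principal_eq_bot.2]
    · exact bot_le
    · filter_upwards [hneg'] with q hq
      exact not_lt.2 hq.le
  · push Not at hsign
    refine ⟨-u, neg_ne_zero.2 hu, ?_, ?_⟩
    · rw [Projectivization.mk_eq_mk_iff']
      exact ⟨-1, by simp⟩
    have hev : ∀ᶠ r in 𝓝[>] t, c r ∈ {q | dotP u (q - c t) ≤ 0} := by
      filter_upwards [hmem] with r hr using hsign r hr
    have := tendsto_inf.2 ⟨hle, tendsto_principal.2 hev⟩
    refine this.mono_right ?_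
    rw [inf_sup_right]
    refine sup_le ?_ inf_le_left
    rw [inf_principal_eq_bot.2]
    · exact bot_le
    · filter_upwards [hpos] with q hq
      exact not_le.2 hq

section Image

variable {f : Plane ≃ₜ Plane}

theorem MapsC1.exists_image_ray (hf : MapsC1 f) {γ : ℝ → Plane} (hγ : IsRegParam γ) (t : ℝ) :
    ∃ (u : Plane) (hu : u ≠ 0),
      TangentAt (f '' Set.range γ) (f (γ t)) (Projectivization.mk ℝ u hu) ∧
      Tendsto (fun s => f (γ s)) (𝓝[>] t) (rayFilter (f (γ t)) u) := by
  obtain ⟨ℓ, hℓ⟩ := (hf _ ⟨γ, hγ, rfl⟩).exists_tangentAt (Set.mem_image_of_mem f ⟨t, rfl⟩)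
  obtain ⟨u, hu, rfl, h⟩ := TangentAt.exists_tendsto_rayFilter (c := fun s => f (γ s)) hℓ
    (f.continuous.comp hγ.1.continuous) (fun s => Set.mem_image_of_mem f ⟨s, rfl⟩) (by
      filter_upwards [nhdsGT_le_nhdsNE t (hγ.eventually_ne t)] with s hs e
      exact hs (f.injective e))
  exact ⟨u, hu, hℓ, h⟩

theorem frequently_rayFilter_prod {p v w : Plane} {P : Plane → Prop}
    (h : ∃ᶠ q in rayFilter p v, P q) : ∃ᶠ z in rayFilter p v ×ˢ 𝓝 w, P z.1 := by
  rw [← map_fst_prod (rayFilter p v) (𝓝 w), frequently_map] at h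
  exact h

theorem exists_isRegParam_tendsto (p : Plane) {v : Plane} (hv : v ≠ 0) :
    ∃ γ : ℝ → Plane, IsRegParam γ ∧ γ 0 = p ∧ ∃ c : ℝ, 0 < c ∧ deriv γ 0 = c • v := by
  have := rayFilter_neBot p hv
  obtain ⟨γ, h1, h2, h3, -⟩ := exists_shearedCircle_through p hv (fun _ _ => True)
    (fun _ => (Eventually.of_forall fun _ => trivial).frequently)
  exact ⟨γ, h1, h2, h3⟩

theorem IsRegParam.tendsto_rayFilter_right {γ : ℝ → Plane} (hγ : IsRegParam γ) {v : Plane}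
    (hv : v ≠ 0) {t c : ℝ} (hc : 0 < c) (h : deriv γ t = c • v) :
    Tendsto γ (𝓝[>] t) (rayFilter (γ t) v) := by
  have := _root_.tendsto_rayFilter_right (hγ.2.2.2 t) (hγ.hasDerivAt t)
  rwa [h, rayFilter_smul _ hv hc] at this

/-- A homeomorphism preserving C¹ curves maps germs along a ray to germs along a ray. -/
theorem MapsC1.tendsto_rayFilter (hf : MapsC1 f) {γ : ℝ → Plane}
    {u v : Plane} (hv : v ≠ 0) (hu : u ≠ 0) {t : ℝ} (ht : Tendsto γ (𝓝[>] t) (rayFilter (γ t) v))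
    (h : Tendsto (fun s => f (γ s)) (𝓝[>] t) (rayFilter (f (γ t)) u)) :
    Tendsto f (rayFilter (γ t) v) (rayFilter (f (γ t)) u) := by
  by_contra hcon
  obtain ⟨S, hS, hSf⟩ : ∃ S ∈ rayFilter (f (γ t)) u, f ⁻¹' S ∉ rayFilter (γ t) v := by
    simpa [Tendsto, not_le, SetLike.le_def, Filter.le_def] using hcon
  obtain ⟨B, hB⟩ := (rayFilter (f (γ t)) u).exists_antitone_basis
  obtain ⟨η, hη, hη0, ⟨c, hc, hηc⟩, τ, w, hτ, hτP⟩ := exists_shearedCircle_through (γ t) hv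
    (fun n z => if Even n then f z.1 ∈ B n else f z.1 ∉ S) (by
      intro n
      by_cases hn : Even n
      · simp only [hn, if_true]
        refine frequently_rayFilter_prod (P := fun q => f q ∈ B n) (ht.frequently ?_)
        exact (h.eventually (hB.1.mem_of_mem trivial)).frequently
      · simp only [hn, if_false]
        exact frequently_rayFilter_prod (P := fun q => f q ∉ S) (not_eventually.1 hSf))
  obtain ⟨u', hu', -, hlim⟩ := hf.exists_image_ray hη 0
  rw [hη0] at hlim
  have h2 : Tendsto (fun n : ℕ => 2 * n) atTop atTop :=
    tendsto_atTop_mono (fun n => by simp only [id]; omega) tendsto_id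
  have h21 : Tendsto (fun n : ℕ => 2 * n + 1) atTop atTop :=
    tendsto_atTop_mono (fun n => (2 * n).le_succ) h2
  have e1 : Tendsto (fun n => f (η (τ (2 * n)))) atTop (rayFilter (f (γ t)) u) :=
    hB.tendsto fun n => hB.antitone (by omega : n ≤ 2 * n) (by simpa using (hτP (2 * n)).1)
  have e2 : Tendsto (fun n => f (η (τ (2 * n)))) atTop (rayFilter (f (γ t)) u') :=
    (hlim.comp hτ).comp h2
  rw [← rayFilter_eq_of_tendsto hu' hu e2 e1] at hlim
  obtain ⟨n, hn⟩ := (((hlim.comp hτ).comp h21).eventually hS).exists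
  have := (hτP (2 * n + 1)).1
  simp at this
  exact this hn

theorem MapsC1.exists_rayFilter (hf : MapsC1 f) (p : Plane) {v : Plane} (hv : v ≠ 0) :
    ∃ u : Plane, u ≠ 0 ∧ Tendsto f (rayFilter p v) (rayFilter (f p) u) := by
  obtain ⟨γ, hγ, rfl, c, hc, hγc⟩ := exists_isRegParam_tendsto p hv
  obtain ⟨u, hu, -, h⟩ := hf.exists_image_ray hγ 0
  exact ⟨u, hu, hf.tendsto_rayFilter hv hu (hγ.tendsto_rayFilter_right hv hc hγc) h⟩

theorem MapsC1.exists_lineFilter (hf : MapsC1 f) (p : Plane) (ℓ : ProjLine) :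
    ∃ ℓ', Tendsto f (lineFilter p ℓ) (lineFilter (f p) ℓ') := by
  induction ℓ using Projectivization.ind with
  | h v hv =>
  obtain ⟨γ, hγ, rfl, c, hc, hγc⟩ := exists_isRegParam_tendsto p hv
  have hv' : -v ≠ 0 := neg_ne_zero.2 hv
  obtain ⟨u, hu, htan, h⟩ := hf.exists_image_ray hγ 0
  obtain ⟨u', hu', htan', h'⟩ := hf.exists_image_ray hγ.comp_neg 0
  have hright := hf.tendsto_rayFilter hv hu (hγ.tendsto_rayFilter_right hv hc hγc) h
  have hleft := hf.tendsto_rayFilter hv' hu'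
    (hγ.comp_neg.tendsto_rayFilter_right hv' hc (by
      rw [deriv_comp_neg, neg_zero, hγc, smul_neg])) h'
  rw [IsRegParam.range_comp_neg] at htan'
  simp only [neg_zero] at htan' hleft
  refine ⟨Projectivization.mk ℝ u hu, ?_⟩
  rw [lineFilter_mk]
  refine (hright.mono_right (rayFilter_le_lineFilter _ hu)).sup (hleft.mono_right ?_)
  rw [htan.unique htan']
  exact rayFilter_le_lineFilter _ hu'

theorem TangentAt.image (hf : MapsC1 f) {Γ : Set Plane} {p : Plane} {ℓ ℓ' : ProjLine}
    (h : TangentAt Γ p ℓ) (hℓ : Tendsto f (lineFilter p ℓ) (lineFilter (f p) ℓ')) :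
    TangentAt (f '' Γ) (f p) ℓ' := by
  obtain ⟨k, hk⟩ := (hf Γ h.isC1Curve).exists_tangentAt (Set.mem_image_of_mem f h.mem)
  have := h.nhdsWithin_neBot
  have e : Tendsto f (𝓝[Γ \ {p}] p) (𝓝[f '' Γ \ {f p}] (f p)) := by
    refine tendsto_nhdsWithin_iff.2
      ⟨f.continuous.continuousAt.tendsto.mono_left nhdsWithin_le_nhds, ?_⟩
    filter_upwards [self_mem_nhdsWithin] with q hq
    exact ⟨Set.mem_image_of_mem f hq.1, fun e => hq.2 (f.injective e)⟩
  rwa [← line_unique (e.mono_right hk.nhdsWithin_le) (hℓ.mono_left h.nhdsWithin_le)]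

theorem exists_tangentAt (p : Plane) (ℓ : ProjLine) : ∃ Γ, TangentAt Γ p ℓ := by
  induction ℓ using Projectivization.ind with
  | h v hv =>
  obtain ⟨γ, hγ, rfl, c, hc, hγc⟩ := exists_isRegParam_tendsto p hv
  refine ⟨_, γ, 0, hγ, rfl, rfl, ?_⟩
  rw [eq_comm, Projectivization.mk_eq_mk_iff']
  exact ⟨c, hγc.symm⟩

end Image

theorem lineFilter_neBot (p : Plane) (ℓ : ProjLine) : (lineFilter p ℓ).NeBot := by
  induction ℓ using Projectivization.ind with
  | h v hv => exact (rayFilter_neBot p hv).mono (rayFilter_le_lineFilter p hv)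

theorem tendsto_secantDir_lineFilter (p : Plane) (ℓ : ProjLine) :
    Tendsto (secantDir p) (lineFilter p ℓ) (𝓝 ℓ) :=
  tendsto_comap.mono_left inf_le_right

theorem continuous_of_tendsto_lineFilter {f : Plane → Plane} {p : Plane} {φ : ProjLine → ProjLine}
    (h : ∀ ℓ, Tendsto f (lineFilter p ℓ) (lineFilter (f p) (φ ℓ))) : Continuous φ := by
  refine continuous_iff_continuousAt.2 fun ℓ => ?_
  refine (closed_nhds_basis (φ ℓ)).tendsto_right_iff.2 fun U ⟨hU, hUc⟩ => ?_
  have h1 : ∀ᶠ q in lineFilter p ℓ, secantDir (f p) (f q) ∈ U :=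
    (h ℓ).eventually ((tendsto_secantDir_lineFilter _ _).eventually hU)
  obtain ⟨W, hW, V, hV, hWV⟩ := mem_inf_iff_superset.1 h1
  obtain ⟨V', hV', hVV'⟩ := mem_comap.1 hV
  filter_upwards [eventually_mem_nhds_iff.2 hV'] with ℓ' hℓ'
  have h2 : ∀ᶠ q in lineFilter p ℓ', secantDir (f p) (f q) ∈ U :=
    mem_inf_iff_superset.2 ⟨W, hW, V, mem_of_superset (preimage_mem_comap hℓ') hVV', hWV⟩
  have := lineFilter_neBot p ℓ'
  exact hUc.mem_of_tendsto ((tendsto_secantDir_lineFilter _ _).comp (h ℓ')) h2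

theorem eq_of_tendsto_lineFilter_comp {f g : Plane → Plane} (hgf : ∀ q, g (f q) = q) {p : Plane}
    {ℓ ℓ' ℓ'' : ProjLine} (hf : Tendsto f (lineFilter p ℓ) (lineFilter (f p) ℓ'))
    (hg : Tendsto g (lineFilter (f p) ℓ') (lineFilter (g (f p)) ℓ'')) : ℓ'' = ℓ := by
  have := lineFilter_neBot p ℓ
  have h := hg.comp hf
  rw [hgf, show g ∘ f = id from funext hgf] at h
  exact line_unique h tendsto_id

theorem InHomeo1.exists_projective_homeomorph {f : Plane ≃ₜ Plane} (hf : InHomeo1 f) :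
    ∃ φ : Plane → (ProjLine ≃ₜ ProjLine), ∀ p ℓ,
      Tendsto f (lineFilter p ℓ) (lineFilter (f p) (φ p ℓ)) ∧
      Tendsto f.symm (lineFilter (f p) (φ p ℓ)) (lineFilter p ℓ) := by
  choose φ hφ using hf.1.exists_lineFilter
  choose φ' hφ' using hf.2.exists_lineFilter
  have hl : ∀ p, Function.LeftInverse (φ' (f p)) (φ p) := fun p ℓ =>
    eq_of_tendsto_lineFilter_comp f.symm_apply_apply (hφ p ℓ) (hφ' (f p) _)
  have hr : ∀ p, Function.RightInverse (φ' (f p)) (φ p) := fun p ℓ => by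
    refine eq_of_tendsto_lineFilter_comp f.apply_symm_apply (hφ' (f p) ℓ) ?_
    rw [f.symm_apply_apply]
    exact hφ p _
  refine ⟨fun p => ⟨⟨φ p, φ' (f p), hl p, hr p⟩, continuous_of_tendsto_lineFilter (hφ p),
    continuous_of_tendsto_lineFilter (hφ' (f p))⟩, fun p ℓ => ⟨hφ p ℓ, ?_⟩⟩
  have := hφ' (f p) (φ p ℓ)
  rwa [hl p ℓ, f.symm_apply_apply] at this

theorem convAlong_iff {p : Plane} {ℓ : ProjLine} {x : ℕ → Plane} :
    ConvAlong p ℓ x ↔ (∀ n, x n ≠ p) ∧ Tendsto x atTop (lineFilter p ℓ) := by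
  rw [tendsto_lineFilter]
  exact ⟨fun ⟨h1, h2, h3⟩ => ⟨h1, h2, Eventually.of_forall h1, h3⟩,
    fun ⟨h1, h2, _, h3⟩ => ⟨h1, h2, h3⟩⟩

/-- A sequence of pointed lines converging to its limit line along that line is
frequently tangent to a single C¹ curve. -/
theorem exists_curve_of_tendsto {p : Plane} {ℓ : ProjLine} {x : ℕ → Plane} {k : ℕ → ProjLine}
    (hx : Tendsto x atTop (lineFilter p ℓ)) (hk : Tendsto k atTop (𝓝 ℓ)) :
    ∃ Γ, TangentAt Γ p ℓ ∧ ∃ m : ℕ → ℕ, StrictMono m ∧ ∀ n, TangentAt Γ (x (m n)) (k (m n)) := by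
  let U : Ultrafilter ℕ := Ultrafilter.of atTop
  have hU : (U : Filter ℕ) ≤ atTop := Ultrafilter.of_le atTop
  obtain ⟨v, hv, rfl, hxv⟩ : ∃ (v : Plane) (hv : v ≠ 0), ℓ = Projectivization.mk ℝ v hv ∧
      Tendsto x U (rayFilter p v) := by
    induction ℓ using Projectivization.ind with
    | h v hv =>
    have h : ((U.map x : Ultrafilter Plane) : Filter Plane) ≤ rayFilter p v ⊔ rayFilter p (-v) := by
      rw [← lineFilter_mk p hv]
      exact hx.mono_left hU
    rcases Ultrafilter.le_sup_iff.1 h with h | h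
    · exact ⟨v, hv, rfl, h⟩
    · refine ⟨-v, neg_ne_zero.2 hv, ?_, h⟩
      rw [Projectivization.mk_eq_mk_iff']
      exact ⟨-1, by simp⟩
  obtain ⟨w, hw, hwk⟩ := exists_tendsto_rep hv (hk.mono_left hU)
  obtain ⟨γ, hγ, rfl, ⟨c, hc, hc0⟩, t, w', ht, hP⟩ := exists_shearedCircle_through p hv
    (fun n z => ∃ m ≥ n, z.1 = x m ∧ ∃ h : z.2 ≠ 0, k m = Projectivization.mk ℝ z.2 h) (by
      intro n
      refine (hxv.prodMk hw).frequently (Eventually.frequently ?_)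
      filter_upwards [hwk, hU (eventually_ge_atTop n)] with i hi hni
      exact ⟨i, hni, rfl, hi⟩)
  choose hP hd using hP
  choose m hm hxm hkm using hP
  have hm' : Tendsto m atTop atTop := tendsto_atTop_mono hm tendsto_id
  obtain ⟨σ, hσ, hmσ⟩ := strictMono_subseq_of_tendsto_atTop hm'
  refine ⟨Set.range γ, ⟨γ, 0, hγ, rfl, rfl, ?_⟩, m ∘ σ, hmσ, fun n =>
    ⟨γ, t (σ n), hγ, rfl, hxm _, ?_⟩⟩
  · rw [eq_comm, Projectivization.mk_eq_mk_iff']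
    exact ⟨c, hc0.symm⟩
  · obtain ⟨h, hk⟩ := hkm (σ n)
    obtain ⟨c, hc⟩ := hd (σ n)
    rw [Function.comp, hk, eq_comm, Projectivization.mk_eq_mk_iff']
    exact ⟨c, hc.symm⟩

theorem InHomeo1.transverseFor {f : Plane ≃ₜ Plane} (hf : InHomeo1 f)
    {φ : Plane → ProjLine → ProjLine} (hφ : ∀ p ℓ,
      Tendsto f (lineFilter p ℓ) (lineFilter (f p) (φ p ℓ)) ∧
      Tendsto f.symm (lineFilter (f p) (φ p ℓ)) (lineFilter p ℓ))
    {p : Plane} {ℓ : ProjLine} {x : ℕ → Plane} {k : ℕ → ProjLine} (h : TransverseFor p ℓ x k) :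
    TransverseFor (f p) (φ p ℓ) (fun n => f (x n)) (fun n => φ (x n) (k n)) := by
  obtain ⟨hconv, h⟩ := h
  obtain ⟨hne, hx⟩ := convAlong_iff.1 hconv
  refine ⟨convAlong_iff.2 ⟨fun n e => hne n (f.injective e), (hφ p ℓ).1.comp hx⟩, ?_⟩
  intro σ hσ hlim
  rw [nhds_prod_eq, tendsto_prod_iff'] at hlim
  obtain ⟨Γ, hΓ, m, hm, hΓm⟩ := exists_curve_of_tendsto
    (((hφ p ℓ).1.comp hx).comp hσ.tendsto_atTop) hlim.2
  have himage : ∀ {q κ}, TangentAt Γ (f q) (φ q κ) → TangentAt (f.symm '' Γ) q κ := by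
    intro q κ hq
    have := hq.image (f := f.symm) (ℓ' := κ) hf.2 (by
      rw [f.symm_apply_apply]
      exact (hφ q κ).2)
    rwa [f.symm_apply_apply] at this
  have hxlim : Tendsto (fun n => x (σ (m n))) atTop (𝓝 p) :=
    ((tendsto_lineFilter.1 hx).1.comp hσ.tendsto_atTop).comp hm.tendsto_atTop
  refine h (σ ∘ m) (hσ.comp hm) ?_
  rw [nhds_prod_eq, tendsto_prod_iff']
  refine ⟨hxlim, fun U hU => ?_⟩
  have hx' : Tendsto (fun n => x (σ (m n))) atTop (𝓝[f.symm '' Γ] p) :=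
    tendsto_nhdsWithin_iff.2 ⟨hxlim, Eventually.of_forall fun n => (himage (hΓm n)).mem⟩
  rw [mem_map]
  filter_upwards [hx'.eventually ((himage hΓ).eventually_tangentAt hU)] with n hn
  exact hn _ (himage (hΓm n))

theorem rayFilter_disjoint_neg (p v : Plane) : Disjoint (rayFilter p v) (rayFilter p (-v)) := by
  have h1 : ∀ᶠ q in rayFilter p v, 0 < dotP v (q - p) :=
    mem_inf_of_right (mem_principal_self _)
  have h2 : ∀ᶠ q in rayFilter p (-v), 0 < dotP (-v) (q - p) :=
    mem_inf_of_right (mem_principal_self _)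
  refine Filter.disjoint_iff.2 ⟨_, h1, _, h2, ?_⟩
  rw [Set.disjoint_left]
  intro q hq hq'
  simp only [Set.mem_ofPred_eq, dotP, Prod.fst_neg, Prod.snd_neg] at hq hq'
  linarith

theorem mk_neg {v : Plane} (hv : v ≠ 0) :
    Projectivization.mk ℝ (-v) (neg_ne_zero.2 hv) = Projectivization.mk ℝ v hv := by
  rw [Projectivization.mk_eq_mk_iff']
  exact ⟨-1, by simp⟩

section Inverse

variable {f : Plane ≃ₜ Plane}

theorem tendsto_symm_lineFilter {p : Plane} {φ : ProjLine → ProjLine} (hinj : φ.Injective)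
    (hφ : ∀ ℓ, Tendsto f (lineFilter p ℓ) (lineFilter (f p) (φ ℓ))) (ℓ : ProjLine) :
    Tendsto f.symm (lineFilter (f p) (φ ℓ)) (lineFilter p ℓ) := by
  refine le_iff_ultrafilter.2 fun V hV => ?_
  have hle : Tendsto f V (lineFilter (f p) (φ ℓ)) := by
    refine (Tendsto.mono_left (tendsto_map' ?_) hV)
    rw [show f ∘ f.symm = id from funext f.apply_symm_apply]
    exact tendsto_id
  have hV' : (V : Filter Plane) ≤ 𝓝[≠] p := by
    refine hV.trans (tendsto_nhdsWithin_iff.2 ⟨?_, ?_⟩)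
    · have := f.symm.continuous.tendsto (f p)
      rw [f.symm_apply_apply] at this
      exact this.mono_left (inf_le_left.trans nhdsWithin_le_nhds)
    · have : ∀ᶠ q in lineFilter (f p) (φ ℓ), q ≠ f p := mem_inf_of_left self_mem_nhdsWithin
      filter_upwards [this] with q hq e
      exact hq (f.symm_apply_eq.1 e)
  obtain ⟨w, hw, hVw⟩ := exists_ultrafilter_le_rayFilter hV'
  have hVw' := hVw.trans (rayFilter_le_lineFilter p hw)
  rwa [← hinj (line_unique ((hφ _).mono_left hVw') hle)]

theorem MapsC1.exists_rayFilter_symm (hf : MapsC1 f) {p : Plane} {φ : ProjLine → ProjLine}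
    (hinj : φ.Injective) (hφ : ∀ ℓ, Tendsto f (lineFilter p ℓ) (lineFilter (f p) (φ ℓ)))
    {v : Plane} (hv : v ≠ 0) :
    ∃ (u : Plane) (hu : u ≠ 0),
      φ (Projectivization.mk ℝ v hv) = Projectivization.mk ℝ u hu ∧
      Tendsto f.symm (rayFilter (f p) u) (rayFilter p v) ∧
      Tendsto f.symm (rayFilter (f p) (-u)) (rayFilter p (-v)) := by
  have hv' : -v ≠ 0 := neg_ne_zero.2 hv
  have := rayFilter_neBot p hv
  have := rayFilter_neBot p hv'
  obtain ⟨u, hu, hvu⟩ := hf.exists_rayFilter p hv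
  obtain ⟨u', hu', hvu'⟩ := hf.exists_rayFilter p hv'
  have hline := hφ (Projectivization.mk ℝ v hv)
  have hline_symm := tendsto_symm_lineFilter hinj hφ (Projectivization.mk ℝ v hv)
  have e : φ (Projectivization.mk ℝ v hv) = Projectivization.mk ℝ u hu :=
    line_unique (hline.mono_left (rayFilter_le_lineFilter p hv))
      (hvu.mono_right (rayFilter_le_lineFilter _ hu))
  have e' : φ (Projectivization.mk ℝ v hv) = Projectivization.mk ℝ u' hu' := by
    rw [← mk_neg hv] at hline ⊢
    exact line_unique (hline.mono_left (rayFilter_le_lineFilter p hv'))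
      (hvu'.mono_right (rayFilter_le_lineFilter _ hu'))
  rw [e, lineFilter_mk, lineFilter_mk] at hline_symm
  have hid : Tendsto (fun q => f (f.symm q)) (rayFilter (f p) u ⊔ rayFilter (f p) (-u))
      (rayFilter (f p) u ⊔ rayFilter (f p) u') := (hvu.sup_sup hvu').comp hline_symm
  simp only [f.apply_symm_apply] at hid
  have hu'' : rayFilter (f p) u' = rayFilter (f p) (-u) := by
    rw [e, eq_comm, Projectivization.mk_eq_mk_iff'] at e'
    obtain ⟨a, rfl⟩ := e'
    rcases lt_trichotomy a 0 with ha | ha | ha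
    · rw [show a • u = (-a) • (-u) by simp, rayFilter_smul _ (neg_ne_zero.2 hu) (neg_pos.2 ha)]
    · simp [ha] at hu'
    · rw [rayFilter_smul _ hu ha, sup_idem] at hid
      have hle : rayFilter (f p) (-u) ≤ rayFilter (f p) u := le_sup_right.trans (tendsto_id'.1 hid)
      have := rayFilter_neBot (f p) (neg_ne_zero.2 hu)
      exact absurd ((rayFilter_disjoint_neg (f p) u).eq_bot_of_ge hle) this.ne
  rw [hu''] at hvu'
  have key : ∀ {u₁ u₂ v₁ v₂ : Plane}, Disjoint (rayFilter (f p) u₁) (rayFilter (f p) u₂) →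
      Tendsto f (rayFilter p v₂) (rayFilter (f p) u₂) →
      Tendsto f.symm (rayFilter (f p) u₁) (rayFilter p v₁ ⊔ rayFilter p v₂) →
      Tendsto f.symm (rayFilter (f p) u₁) (rayFilter p v₁) := by
    intro u₁ u₂ v₁ v₂ hd h2 h
    refine le_iff_ultrafilter.2 fun V hV => ?_
    rcases Ultrafilter.le_sup_iff.1 (hV.trans h) with h1 | h1
    · exact h1
    · have hle : Tendsto f V (rayFilter (f p) u₁) := by
        refine (Tendsto.mono_left (tendsto_map' ?_) hV)
        rw [show f ∘ f.symm = id from funext f.apply_symm_apply]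
        exact tendsto_id
      have h2' : Tendsto f V (rayFilter (f p) u₂) := h2.mono_left h1
      exact absurd (hd hle h2') (by simpa using (V.neBot.map f).ne)
  refine ⟨u, hu, e, key (rayFilter_disjoint_neg _ _) hvu' (hline_symm.mono_left le_sup_left),
    key (rayFilter_disjoint_neg _ _).symm hvu ?_⟩
  rw [sup_comm]
  exact hline_symm.mono_left le_sup_right

theorem MapsC1.exists_tangent_symm (hf : MapsC1 f) {φ : Plane → ProjLine → ProjLine}
    (hbij : ∀ p, (φ p).Bijective)
    (hφ : ∀ p ℓ, Tendsto f (lineFilter p ℓ) (lineFilter (f p) (φ p ℓ))) {γ : ℝ → Plane}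
    (hγ : IsRegParam γ) (t : ℝ) :
    ∃ (v : Plane) (hv : v ≠ 0), φ (f.symm (γ t)) (Projectivization.mk ℝ v hv) =
        Projectivization.mk ℝ (deriv γ t) (hγ.2.2.2 t) ∧
      Tendsto (fun s => f.symm (γ s)) (𝓝[>] t) (rayFilter (f.symm (γ t)) v) ∧
      Tendsto (fun s => f.symm (γ s)) (𝓝[<] t) (rayFilter (f.symm (γ t)) (-v)) := by
  obtain ⟨ℓ, hℓ⟩ := (hbij (f.symm (γ t))).2 (Projectivization.mk ℝ (deriv γ t) (hγ.2.2.2 t))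
  induction ℓ using Projectivization.ind with
  | h v hv =>
  obtain ⟨u, hu, he, h1, h2⟩ := hf.exists_rayFilter_symm (hbij _).1 (hφ _) hv
  rw [f.apply_symm_apply] at h1 h2
  have hR := tendsto_rayFilter_right (hγ.2.2.2 t) (hγ.hasDerivAt t)
  have hL := tendsto_rayFilter_left (hγ.2.2.2 t) (hγ.hasDerivAt t)
  have hγ0 := hγ.2.2.2 t
  rw [hℓ, Projectivization.mk_eq_mk_iff'] at he
  obtain ⟨a, ha⟩ := he
  rw [← ha] at hR hL hγ0
  rcases lt_trichotomy a 0 with h | h | h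
  · rw [show a • u = (-a) • (-u) by simp] at hR hL
    rw [rayFilter_smul _ (neg_ne_zero.2 hu) (neg_pos.2 h)] at hR
    rw [← smul_neg, neg_neg, rayFilter_smul _ hu (neg_pos.2 h)] at hL
    refine ⟨-v, neg_ne_zero.2 hv, by rw [mk_neg hv, hℓ], h2.comp hR, ?_⟩
    rw [neg_neg]
    exact h1.comp hL
  · simp [h] at hγ0
  · rw [rayFilter_smul _ hu h] at hR
    rw [← smul_neg, rayFilter_smul _ (neg_ne_zero.2 hu) h] at hL
    exact ⟨v, hv, hℓ, h1.comp hR, h2.comp hL⟩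

theorem continuous_tangent_symm {φ : Plane → ProjLine → ProjLine}
    (htrans : ∀ p ℓ x k, TransverseFor p ℓ x k →
      Transverse (fun n => f (x n)) (fun n => φ (x n) (k n))) {γ : ℝ → Plane}
    (hγ : IsRegParam γ) {κ : ℝ → ProjLine}
    (hκ : ∀ t, φ (f.symm (γ t)) (κ t) = Projectivization.mk ℝ (deriv γ t) (hγ.2.2.2 t))
    (hlim : ∀ t, Tendsto (fun s => f.symm (γ s)) (𝓝[≠] t) (lineFilter (f.symm (γ t)) (κ t))) :
    Continuous κ := by
  refine continuous_iff_continuousAt.2 fun t => ?_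
  rw [continuousAt_iff_punctured_nhds]
  by_contra hcon
  obtain ⟨V, hV, hVκ⟩ : ∃ V ∈ 𝓝 (κ t), ¬ ∀ᶠ s in 𝓝[≠] t, κ s ∈ V := by
    by_contra! h
    exact hcon h
  obtain ⟨s, hs, hsV⟩ := exists_seq_forall_of_frequently
    ((not_eventually.1 hVκ).and_eventually (hγ.eventually_ne t))
  obtain ⟨p', ℓ', hconv, hnot⟩ := htrans (f.symm (γ t)) (κ t) (fun n => f.symm (γ (s n)))
    (fun n => κ (s n)) ⟨convAlong_iff.2 ⟨fun n e => (hsV n).2 (f.symm.injective e),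
      (hlim t).comp hs⟩, fun σ hσ h => by
      rw [nhds_prod_eq, tendsto_prod_iff'] at h
      obtain ⟨n, hn⟩ := (h.2.eventually hV).exists
      exact (hsV (σ n)).1 hn⟩
  simp only [f.apply_symm_apply, hκ] at hconv hnot
  have hγs : Tendsto (fun n => γ (s n)) atTop
      (lineFilter (γ t) (Projectivization.mk ℝ (deriv γ t) (hγ.2.2.2 t))) :=
    (tendsto_lineFilter_of_hasDerivAt (hγ.2.2.2 t) (hγ.hasDerivAt t)).comp hs
  have hp : γ t = p' := tendsto_nhds_unique (tendsto_lineFilter.1 hγs).1 hconv.2.1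
  subst hp
  have hℓ := line_unique hγs (convAlong_iff.1 hconv).2
  subst hℓ
  refine hnot id strictMono_id ?_
  rw [nhds_prod_eq]
  exact (tendsto_lineFilter.1 hγs).1.prodMk
    ((hγ.continuous_mk_deriv.tendsto t).comp (hs.mono_right nhdsWithin_le_nhds))

end Inverse

/-- The path `α` has the two opposite one-sided tangent rays spanned by `v t` and `-v t`,
on a line depending continuously on the parameter. -/
structure HasContinuousTangentLine (α v : ℝ → Plane) : Prop where
  continuous : Continuous α
  ne_zero : ∀ t, v t ≠ 0
  right : ∀ t, Tendsto α (𝓝[>] t) (rayFilter (α t) (v t))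
  left : ∀ t, Tendsto α (𝓝[<] t) (rayFilter (α t) (-v t))
  continuous_mk : Continuous fun t => Projectivization.mk ℝ (v t) (ne_zero t)

theorem dotP_sub (m x y : Plane) : dotP m (x - y) = dotP m x - dotP m y := by
  simp only [dotP, Prod.fst_sub, Prod.snd_sub]
  ring

theorem dotP_neg (m x : Plane) : dotP m (-x) = -dotP m x := by
  simp only [dotP, Prod.fst_neg, Prod.snd_neg]
  ring

theorem dotP_neg_left (m x : Plane) : dotP (-m) x = -dotP m x := by
  simp only [dotP, Prod.fst_neg, Prod.snd_neg]
  ring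

theorem norm_rotP (v : Plane) : ‖rotP v‖ = ‖v‖ := by
  simp only [rotP, Prod.norm_def, norm_neg]
  exact max_comm _ _

namespace HasContinuousTangentLine

variable {α v : ℝ → Plane}

theorem eventually_lt (h : HasContinuousTangentLine α v) {m : Plane} {t : ℝ}
    (hm : 0 < dotP m (v t)) :
    (∀ᶠ s in 𝓝[>] t, dotP m (α t) < dotP m (α s)) ∧
      ∀ᶠ s in 𝓝[<] t, dotP m (α s) < dotP m (α t) := by
  constructor
  · filter_upwards [eventually_dotP_pos (h.ne_zero t) (h.right t) hm] with s hs
    rw [dotP_sub] at hs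
    linarith
  · have hm' : 0 < dotP (-m) (-v t) := by rwa [dotP_neg, dotP_neg_left, neg_neg]
    filter_upwards [eventually_dotP_pos (neg_ne_zero.2 (h.ne_zero t)) (h.left t) hm'] with s hs
    rw [dotP_neg_left, dotP_sub] at hs
    linarith

theorem not_isLocalExtr (h : HasContinuousTangentLine α v) {m : Plane} {t : ℝ}
    (hm : 0 < dotP m (v t)) : ¬ IsLocalExtr (fun s => dotP m (α s)) t := by
  obtain ⟨h1, h2⟩ := h.eventually_lt hm
  rintro (hmin | hmax)
  · obtain ⟨s, hs, hs'⟩ := (h2.and (hmin.filter_mono nhdsWithin_le_nhds)).exists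
    exact absurd hs (not_lt.2 hs')
  · obtain ⟨s, hs, hs'⟩ := (h1.and (hmax.filter_mono nhdsWithin_le_nhds)).exists
    exact absurd hs (not_lt.2 hs')

theorem eventually_dotP_ne_zero (h : HasContinuousTangentLine α v) {m : Plane} {t : ℝ}
    (hm : dotP m (v t) ≠ 0) : ∀ᶠ s in 𝓝 t, dotP m (v s) ≠ 0 := by
  have hm0 : rotP m ≠ 0 := by
    intro e
    have h1 : m.2 = 0 := by simpa [rotP] using congrArg Prod.fst e
    have h2 : m.1 = 0 := by simpa [rotP] using congrArg Prod.snd e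
    simp [dotP, h1, h2] at hm
  have hne : Projectivization.mk ℝ (v t) (h.ne_zero t) ≠ Projectivization.mk ℝ (rotP m) hm0 := by
    rw [Ne, Projectivization.mk_eq_mk_iff']
    rintro ⟨a, ha⟩
    refine hm ?_
    rw [← ha]
    simp only [dotP, rotP, Prod.smul_mk, smul_eq_mul]
    ring
  filter_upwards [h.continuous_mk.continuousAt.eventually_ne hne] with s hs e
  refine hs (mk_eq_mk_of_crossP hm0 (h.ne_zero s) ?_)
  simp only [crossP, rotP, dotP] at e ⊢
  linarith

theorem exists_strictMonoOn (h : HasContinuousTangentLine α v) {m : Plane} {t : ℝ}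
    (hm : 0 < dotP m (v t)) :
    ∃ δ > 0, StrictMonoOn (fun s => dotP m (α s)) (Set.Ioo (t - δ) (t + δ)) := by
  obtain ⟨δ, hδ, hball⟩ := Metric.eventually_nhds_iff_ball.1 (h.eventually_dotP_ne_zero hm.ne')
  rw [Real.ball_eq_Ioo] at hball
  have hcont : Continuous fun s => dotP m (α s) := (continuous_dotP m).comp h.continuous
  have hextr : ∀ s ∈ Set.Ioo (t - δ) (t + δ), ¬ IsLocalExtr (fun s => dotP m (α s)) s := by
    intro s hs
    rcases lt_or_gt_of_ne (hball s hs) with hneg | hpos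
    · intro he
      refine h.not_isLocalExtr (m := -m) (t := s) (by rw [dotP_neg_left]; linarith) ?_
      simp only [dotP_neg_left]
      exact he.neg
    · exact h.not_isLocalExtr hpos
  have key : ∀ a ∈ Set.Ioo (t - δ) (t + δ), ∀ b ∈ Set.Ioo (t - δ) (t + δ), a < b →
      dotP m (α a) ≠ dotP m (α b) := by
    intro a ha b hb hab e
    obtain ⟨c, hc, hce⟩ := exists_isLocalExtr_Ioo hab hcont.continuousOn e
    exact hextr c ⟨ha.1.trans hc.1, hc.2.trans hb.2⟩ hce
  have hinj : Set.InjOn (fun s => dotP m (α s)) (Set.Ioo (t - δ) (t + δ)) := by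
    intro a ha b hb e
    rcases lt_trichotomy a b with hab | hab | hab
    · exact absurd e (key a ha b hb hab)
    · exact hab
    · exact absurd e.symm (key b hb a ha hab)
  refine ⟨δ, hδ, (hcont.continuousOn.strictMonoOn_of_injOn_Ioo (by linarith) hinj).resolve_right
    fun hanti => ?_⟩
  have hmem : ∀ᶠ s in 𝓝[>] t, s ∈ Set.Ioo t (t + δ) := Ioo_mem_nhdsGT (by linarith)
  obtain ⟨s, hs, hs'⟩ := ((h.eventually_lt hm).1.and hmem).exists
  have := hanti ⟨by linarith, by linarith⟩ ⟨by linarith [hs'.1], hs'.2⟩ hs'.1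
  exact lt_asymm hs this

theorem exists_local_coordinate (h : HasContinuousTangentLine α v) (t : ℝ) :
    ∃ (u : Plane) (L : ℝ → ℝ), ‖u‖ = 1 ∧ Continuous L ∧ ∀ η > 0, ∃ δ > 0, ∀ s s',
      t - δ < s → s < s' → s' < t + δ → 0 < L s' - L s ∧
        ‖α s' - α s - (L s' - L s) • u‖ ≤ η * (L s' - L s) := by
  have hv := h.ne_zero t
  have hN := dotP_self_pos hv
  have hn : 0 < ‖v t‖ := norm_pos_iff.2 hv
  refine ⟨‖v t‖⁻¹ • v t, fun s => ‖v t‖ / dotP (v t) (v t) * dotP (v t) (α s), ?_, ?_, ?_⟩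
  · rw [norm_smul, norm_inv, norm_norm, inv_mul_cancel₀ hn.ne']
  · exact continuous_const.mul ((continuous_dotP _).comp h.continuous)
  intro η hη
  have hpm : ∀ x, dotP (η • v t + rotP (v t)) x = η * dotP (v t) x + crossP (v t) x ∧
      dotP (η • v t - rotP (v t)) x = η * dotP (v t) x - crossP (v t) x := by
    intro x
    simp only [dotP, crossP, rotP, Prod.fst_add, Prod.snd_add, Prod.fst_sub, Prod.snd_sub,
      Prod.smul_fst, Prod.smul_snd, smul_eq_mul]
    constructor <;> ring
  obtain ⟨δ, hδ, hmono⟩ := h.exists_strictMonoOn (m := η • v t + rotP (v t)) (t := t) (by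
    rw [(hpm _).1, crossP_self, add_zero]
    positivity)
  obtain ⟨δ', hδ', hmono'⟩ := h.exists_strictMonoOn (m := η • v t - rotP (v t)) (t := t) (by
    rw [(hpm _).2, crossP_self, sub_zero]
    positivity)
  refine ⟨min δ δ', lt_min hδ hδ', fun s s' hs hss hs' => ?_⟩
  have hmin := min_le_left δ δ'
  have hmin' := min_le_right δ δ'
  have h1 := sub_pos.2 (hmono ⟨by linarith, by linarith⟩ ⟨by linarith, by linarith⟩ hss)
  have h2 := sub_pos.2 (hmono' ⟨by linarith, by linarith⟩ ⟨by linarith, by linarith⟩ hss)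
  simp only [← dotP_sub] at h1 h2
  rw [(hpm _).1] at h1
  rw [(hpm _).2] at h2
  set w := α s' - α s
  have hd : 0 < dotP (v t) w := by nlinarith
  have hL : ‖v t‖ / dotP (v t) (v t) * dotP (v t) (α s') -
      ‖v t‖ / dotP (v t) (v t) * dotP (v t) (α s) = ‖v t‖ / dotP (v t) (v t) * dotP (v t) w := by
    rw [← mul_sub, ← dotP_sub]
  have hcr : |crossP (v t) w| ≤ η * dotP (v t) w := by
    rw [abs_le]
    constructor <;> linarith
  rw [hL]
  refine ⟨by positivity, ?_⟩
  have e : w - (‖v t‖ / dotP (v t) (v t) * dotP (v t) w) • ‖v t‖⁻¹ • v t =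
      ((dotP (v t) (v t))⁻¹ * crossP (v t) w) • rotP (v t) := by
    have h3 : w = (dotP (v t) (v t))⁻¹ • (dotP (v t) (v t) • w) :=
      (inv_smul_smul₀ hN.ne' w).symm
    rw [dotP_smul_eq] at h3
    nth_rewrite 1 [h3]
    rw [smul_add, smul_smul, smul_smul, smul_smul, add_comm, add_sub_assoc, ← sub_smul]
    convert add_zero _
    rw [smul_eq_zero]
    left
    field_simp
    ring
  rw [e, norm_smul, norm_rotP, norm_mul, norm_inv, Real.norm_eq_abs, Real.norm_eq_abs,
    abs_of_pos hN]
  calc (dotP (v t) (v t))⁻¹ * |crossP (v t) w| * ‖v t‖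
      ≤ (dotP (v t) (v t))⁻¹ * (η * dotP (v t) w) * ‖v t‖ := by gcongr
    _ = η * (‖v t‖ / dotP (v t) (v t) * dotP (v t) w) := by ring

end HasContinuousTangentLine

theorem eVariationOn_Icc_le {α : ℝ → Plane} {L : ℝ → ℝ} {a b C : ℝ} (hab : a ≤ b)
    (h : ∀ s s', a ≤ s → s < s' → s' ≤ b → ‖α s' - α s‖ ≤ C * (L s' - L s)) :
    eVariationOn α (Set.Icc a b) ≤ ENNReal.ofReal (C * (L b - L a)) := by
  have hmono : MonotoneOn (fun s => C * L s) (Set.Icc a b) := by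
    intro s hs s' hs' hle
    rcases hle.eq_or_lt with rfl | hlt
    · exact le_rfl
    · have := (norm_nonneg _).trans (h s s' hs.1 hlt hs'.2)
      simp only
      linarith
  have hle := hmono.eVariationOn_eq (Set.left_mem_Icc.2 hab) (Set.right_mem_Icc.2 hab)
  rw [Set.inter_self] at hle
  rw [mul_sub, ← hle]
  refine iSup_mono fun p => Finset.sum_le_sum fun i _ => ?_
  have h1 := p.2.2.1 (Nat.le_succ i)
  have h2 := p.2.2.2 i
  have h3 := p.2.2.2 (i + 1)
  rcases h1.eq_or_lt with he | hlt
  · rw [Nat.succ_eq_add_one] at he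
    rw [he]
    simp
  · rw [edist_dist, edist_dist]
    apply ENNReal.ofReal_le_ofReal
    rw [dist_eq_norm, Real.dist_eq]
    refine (h _ _ h2.1 hlt h3.2).trans ?_
    rw [mul_sub]
    exact le_abs_self _

namespace HasContinuousTangentLine

variable {α v : ℝ → Plane}

theorem locallyBoundedVariationOn (h : HasContinuousTangentLine α v) :
    LocallyBoundedVariationOn α Set.univ := by
  have key : ∀ x y : ℝ, eVariationOn α (Set.uIcc x y) ≠ ⊤ := by
    intro x y
    have hsymm : Std.Symm fun x y : ℝ => eVariationOn α (Set.uIcc x y) ≠ ⊤ :=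
      ⟨fun a b hab => by rwa [Set.uIcc_comm]⟩
    refine PreconnectedSpace.induction₂ (fun x y : ℝ => eVariationOn α (Set.uIcc x y) ≠ ⊤)
      (fun x => ?_) ⟨fun a b c hab hbc => ?_⟩ x y
    · obtain ⟨u, L, hu, -, hL⟩ := h.exists_local_coordinate x
      obtain ⟨δ, hδ, H⟩ := hL 1 one_pos
      filter_upwards [Ioo_mem_nhds (sub_lt_self x hδ) (lt_add_of_pos_right x hδ)] with y hy
      refine ne_top_of_le_ne_top ENNReal.ofReal_ne_top
        (eVariationOn_Icc_le (C := 2) (L := L) (min_le_max) fun s s' hs hss hs' => ?_)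
      have hs1 : x - δ < s := lt_of_lt_of_le (lt_min (by linarith) hy.1) hs
      have hs2 : s' < x + δ := lt_of_le_of_lt hs' (max_lt (by linarith) hy.2)
      obtain ⟨h1, h2⟩ := H s s' hs1 hss hs2
      have h3 := norm_sub_norm_le (α s' - α s) ((L s' - L s) • u)
      rw [norm_smul, hu, Real.norm_of_nonneg h1.le] at h3
      linarith
    · have hunion : ∀ {a b c : ℝ}, a ≤ b → b ≤ c → eVariationOn α (Set.uIcc a b) ≠ ⊤ →
          eVariationOn α (Set.uIcc b c) ≠ ⊤ → eVariationOn α (Set.uIcc a c) ≠ ⊤ := by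
        intro a b c hab hbc h1 h2
        have := eVariationOn.Icc_add_Icc α hab hbc (Set.mem_univ b)
        simp only [Set.univ_inter] at this
        rw [Set.uIcc_of_le hab] at h1
        rw [Set.uIcc_of_le hbc] at h2
        rw [Set.uIcc_of_le (hab.trans hbc), ← this]
        exact ENNReal.add_ne_top.2 ⟨h1, h2⟩
      by_cases hb : b ∈ Set.uIcc a c
      · rcases Set.mem_uIcc.1 hb with hb | hb
        · exact hunion hb.1 hb.2 hab hbc
        · rw [Set.uIcc_comm] at hab hbc ⊢
          exact hunion hb.1 hb.2 hbc hab
      · rw [Set.mem_uIcc] at hb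
        rcases le_total a b with h1 | h1 <;> rcases le_total a c with h2 | h2 <;>
          first
          | exact ne_top_of_le_ne_top hab (eVariationOn.mono _ (Set.uIcc_subset_uIcc_left
              (Set.mem_uIcc.2 (by grind))))
          | exact ne_top_of_le_ne_top hbc (eVariationOn.mono _ (Set.uIcc_subset_uIcc_right
              (Set.mem_uIcc.2 (by grind))))
  intro a b _ _
  rcases le_total a b with hab | hab
  · rw [Set.univ_inter, ← Set.uIcc_of_le hab]
    exact key a b
  · refine ne_top_of_le_ne_top (key a b) (eVariationOn.mono _ ?_)
    rw [Set.univ_inter, Set.uIcc_of_ge hab]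
    intro z hz
    exact ⟨hab.trans hz.1, hz.2.trans hab⟩

theorem exists_arcLength (h : HasContinuousTangentLine α v) (hper : Function.Periodic α 1) :
    ∃ σ : ℝ → ℝ, Continuous σ ∧ StrictMono σ ∧ (∀ t, σ (t + 1) = σ t + (σ 1 - σ 0)) ∧
      ∀ t, ∃ u : Plane, ‖u‖ = 1 ∧ ∀ η > 0, ∃ δ > 0, ∀ s s', t - δ < s → s < s' → s' < t + δ →
        ‖α s' - α s - (σ s' - σ s) • u‖ ≤ η * (σ s' - σ s) := by
  have hbv := h.locallyBoundedVariationOn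
  set σ : ℝ → ℝ := variationOnFromTo α Set.univ 0 with hσ
  have hsub : ∀ s s', s ≤ s' → σ s' - σ s = (eVariationOn α (Set.Icc s s')).toReal := by
    intro s s' hs
    rw [hσ, variationOnFromTo.sub_right hbv (Set.mem_univ _) (Set.mem_univ _) (Set.mem_univ _),
      variationOnFromTo.eq_of_le _ _ hs, Set.univ_inter]
  have htop : ∀ s s', eVariationOn α (Set.Icc s s') ≠ ⊤ := by
    intro s s'
    have := hbv s s' (Set.mem_univ _) (Set.mem_univ _)
    rwa [Set.univ_inter] at this
  have hnorm : ∀ s s', s ≤ s' → ‖α s' - α s‖ ≤ σ s' - σ s := by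
    intro s s' hs
    rw [hsub s s' hs, ← dist_eq_norm, ← ENNReal.ofReal_le_iff_le_toReal (htop s s'), ← edist_dist]
    exact eVariationOn.edist_le _ (Set.right_mem_Icc.2 hs) (Set.left_mem_Icc.2 hs)
  have hlocal : ∀ t, ∃ (u : Plane) (L : ℝ → ℝ), ‖u‖ = 1 ∧ Continuous L ∧ ∀ η > 0, η ≤ 1 / 2 →
      ∃ δ > 0, ∀ s s', t - δ < s → s < s' → s' < t + δ →
        0 < L s' - L s ∧ (1 - η) * (L s' - L s) ≤ σ s' - σ s ∧
          σ s' - σ s ≤ (1 + η) * (L s' - L s) ∧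
          ‖α s' - α s - (L s' - L s) • u‖ ≤ η * (L s' - L s) := by
    intro t
    obtain ⟨u, L, hu, hLc, hL⟩ := h.exists_local_coordinate t
    refine ⟨u, L, hu, hLc, fun η hη hη2 => ?_⟩
    obtain ⟨δ, hδ, H⟩ := hL η hη
    refine ⟨δ, hδ, fun s s' hs hss hs' => ?_⟩
    obtain ⟨h1, h2⟩ := H s s' hs hss hs'
    have h3 : ‖(L s' - L s) • u‖ = L s' - L s := by
      rw [norm_smul, hu, Real.norm_of_nonneg h1.le, mul_one]
    have h4 := norm_sub_norm_le ((L s' - L s) • u) (α s' - α s)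
    rw [norm_sub_rev _ (α s' - α s), h3] at h4
    have h5 := hnorm s s' hss.le
    refine ⟨h1, by linarith, ?_, h2⟩
    rw [hsub s s' hss.le]
    refine ENNReal.toReal_le_of_le_ofReal (by positivity)
      (eVariationOn_Icc_le hss.le fun r r' hr hrr hr' => ?_)
    obtain ⟨g1, g2⟩ := H r r' (hs.trans_le hr) hrr (hr'.trans_lt hs')
    have g4 := norm_sub_norm_le (α r' - α r) ((L r' - L r) • u)
    rw [norm_smul, hu, Real.norm_of_nonneg g1.le] at g4
    linarith
  have hmono : Monotone σ := by
    intro s s' hs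
    have := hnorm s s' hs
    linarith [norm_nonneg (α s' - α s)]
  refine ⟨σ, ?_, ?_, ?_, ?_⟩
  · rw [continuous_iff_continuousAt]
    intro t
    obtain ⟨u, L, hu, hLc, hL⟩ := hlocal t
    obtain ⟨δ, hδ, H⟩ := hL (1 / 2) (by norm_num) le_rfl
    rw [ContinuousAt, tendsto_iff_dist_tendsto_zero]
    have hlim : Tendsto (fun s => 2 * |L s - L t|) (𝓝 t) (𝓝 0) := by
      have : Continuous fun s => 2 * |L s - L t| := by fun_prop
      simpa using this.tendsto t
    refine squeeze_zero' (Eventually.of_forall fun _ => dist_nonneg) ?_ hlim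
    filter_upwards [Ioo_mem_nhds (sub_lt_self t hδ) (lt_add_of_pos_right t hδ)] with s hs
    rw [Real.dist_eq]
    rcases lt_trichotomy s t with hst | rfl | hst
    · obtain ⟨h1, -, h3, -⟩ := H s t hs.1 hst (by linarith)
      rw [abs_sub_comm, abs_sub_comm (L s), abs_of_pos h1,
        abs_of_nonneg (sub_nonneg.2 (hmono hst.le))]
      linarith
    · simp
    · obtain ⟨h1, -, h3, -⟩ := H t s (by linarith) hst hs.2
      rw [abs_of_pos h1, abs_of_nonneg (sub_nonneg.2 (hmono hst.le))]
      linarith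
  · intro s s' hs
    obtain ⟨u, L, hu, hLc, hL⟩ := hlocal s
    obtain ⟨δ, hδ, H⟩ := hL (1 / 2) (by norm_num) le_rfl
    obtain ⟨r, hr, hr'⟩ := exists_between (lt_min hs (lt_add_of_pos_right s hδ))
    obtain ⟨h1, h2, -, -⟩ := H s r (by linarith) hr (hr'.trans_le (min_le_right _ _))
    have := hmono (hr'.trans_le (min_le_left _ _)).le
    linarith
  · have hshift : ∀ s s', s ≤ s' → σ (s' + 1) - σ (s + 1) = σ s' - σ s := by
      intro s s' hs
      rw [hsub s s' hs, hsub _ _ (by linarith : s + 1 ≤ s' + 1)]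
      have := eVariationOn.comp_eq_of_monotoneOn α (t := Set.Icc s s') (fun x => x + 1)
        (fun a _ b _ hab => by simpa using hab)
      rw [Set.image_add_const_Icc] at this
      rw [← this]
      congr 2
      funext x
      exact hper x
    intro t
    rcases le_total 0 t with ht | ht
    · have := hshift 0 t ht
      rw [zero_add] at this
      linarith
    · have := hshift t 0 ht
      rw [zero_add] at this
      linarith
  · intro t
    obtain ⟨u, L, hu, hLc, hL⟩ := hlocal t
    refine ⟨u, hu, fun η hη => ?_⟩
    obtain ⟨δ, hδ, H⟩ := hL (min (η / 4) (1 / 2)) (by positivity) (min_le_right _ _)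
    refine ⟨δ, hδ, fun s s' hs hss hs' => ?_⟩
    obtain ⟨h1, h2, h3, h4⟩ := H s s' hs hss hs'
    have e1 := min_le_left (η / 4) (1 / 2 : ℝ)
    have e2 := min_le_right (η / 4) (1 / 2 : ℝ)
    set ε := min (η / 4) (1 / 2 : ℝ)
    have h5 : |(L s' - L s) - (σ s' - σ s)| ≤ ε * (L s' - L s) := by
      rw [abs_le]
      constructor <;> linarith
    calc ‖α s' - α s - (σ s' - σ s) • u‖
        = ‖(α s' - α s - (L s' - L s) • u) + ((L s' - L s) - (σ s' - σ s)) • u‖ := by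
          congr 1
          module
      _ ≤ ε * (L s' - L s) + ε * (L s' - L s) := by
          refine (norm_add_le _ _).trans (add_le_add h4 ?_)
          rwa [norm_smul, hu, mul_one, Real.norm_eq_abs]
      _ = 2 * ε * (L s' - L s) := by ring
      _ ≤ 2 * (η / 4) * (L s' - L s) := by gcongr
      _ = η * ((1 - 1 / 2) * (L s' - L s)) := by ring
      _ ≤ η * ((1 - ε) * (L s' - L s)) := by gcongr
      _ ≤ η * (σ s' - σ s) := by gcongr

end HasContinuousTangentLine

theorem exists_hasDerivAt_continuous_of_strict {β : ℝ → Plane} {u : ℝ → Plane}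
    (h : ∀ t, ∀ η > 0, ∀ᶠ q : ℝ × ℝ in 𝓝 (t, t),
      ‖β q.1 - β q.2 - (q.1 - q.2) • u t‖ ≤ η * |q.1 - q.2|) :
    (∀ t, HasDerivAt β (u t) t) ∧ Continuous u := by
  have hder : ∀ t, HasDerivAt β (u t) t := by
    intro t
    rw [hasDerivAt_iff_isLittleO, Asymptotics.isLittleO_iff]
    intro c hc
    have : Tendsto (fun s : ℝ => (s, t)) (𝓝 t) (𝓝 (t, t)) :=
      (Continuous.prodMk continuous_id continuous_const).tendsto t
    exact this.eventually (h t c hc)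
  refine ⟨hder, continuous_iff_continuousAt.2 fun t => ?_⟩
  rw [ContinuousAt, Metric.tendsto_nhds]
  intro ε hε
  have h1 := (h t (ε / 2) (half_pos hε)).eventually_nhds
  have h2 : Tendsto (fun s : ℝ => (s, s)) (𝓝 t) (𝓝 (t, t)) :=
    (Continuous.prodMk continuous_id continuous_id).tendsto t
  filter_upwards [h2.eventually h1] with s hs
  have h3 : Tendsto (fun r : ℝ => (r, s)) (𝓝 s) (𝓝 (s, s)) :=
    (Continuous.prodMk continuous_id continuous_const).tendsto s
  have h4 : HasDerivAt (fun r => β r - r • u t) (u s - (1 : ℝ) • u t) s :=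
    (hder s).sub ((hasDerivAt_id s).smul_const (u t))
  have h5 := h4.le_of_lip' (half_pos hε).le <| by
    filter_upwards [h3.eventually hs] with r hr
    rw [Real.norm_eq_abs]
    convert hr using 1
    congr 1
    module
  rw [one_smul] at h5
  rw [dist_eq_norm]
  linarith

theorem HasContinuousTangentLine.isC1Curve_range {α v : ℝ → Plane}
    (h : HasContinuousTangentLine α v) (hper : Function.Periodic α 1)
    (hinj : ∀ s t, α s = α t → |s - t| < 1 → s = t) : IsC1Curve (Set.range α) := by
  obtain ⟨σ, hσc, hσm, hσp, hσ⟩ := h.exists_arcLength hper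
  choose u hu hσ using hσ
  set c := σ 1 - σ 0 with hc
  have hc0 : 0 < c := sub_pos.2 (hσm one_pos)
  have hnat : ∀ (n : ℕ) t, σ (t + n) = σ t + n * c := by
    intro n
    induction n with
    | zero => simp
    | succ n ih =>
      intro t
      push_cast
      rw [← add_assoc, hσp, ih]
      ring
  have htop : Tendsto σ atTop atTop := by
    refine tendsto_atTop_atTop_of_monotone hσm.monotone fun b => ?_
    obtain ⟨n, hn⟩ := Archimedean.arch (b - σ 0) hc0
    rw [nsmul_eq_mul] at hn
    refine ⟨0 + n, ?_⟩
    rw [hnat]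
    linarith
  have hbot : Tendsto σ atBot atBot := by
    refine tendsto_atBot_atBot_of_monotone hσm.monotone fun b => ?_
    obtain ⟨n, hn⟩ := Archimedean.arch (σ 0 - b) hc0
    rw [nsmul_eq_mul] at hn
    refine ⟨-n, ?_⟩
    have := hnat n (-n)
    rw [neg_add_cancel] at this
    linarith
  let e : ℝ ≃o ℝ := hσm.orderIsoOfSurjective σ (hσc.surjective htop hbot)
  have he : ∀ t, e.symm (σ t) = t := e.symm_apply_apply
  have he' : ∀ s, σ (e.symm s) = s := e.apply_symm_apply
  have hstrict : ∀ t, ∀ η > 0, ∀ᶠ q : ℝ × ℝ in 𝓝 (t, t),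
      ‖α (e.symm q.1) - α (e.symm q.2) - (q.1 - q.2) • u (e.symm t)‖ ≤ η * |q.1 - q.2| := by
    intro t η hη
    obtain ⟨δ, hδ, H⟩ := hσ (e.symm t) η hη
    have hI := (e.symm.continuous.tendsto t).eventually
      (Ioo_mem_nhds (sub_lt_self (e.symm t) hδ) (lt_add_of_pos_right _ hδ))
    filter_upwards [hI.prod_nhds hI] with q hq
    rcases lt_trichotomy q.1 q.2 with hlt | heq | hlt
    · have := H _ _ hq.1.1 (e.symm.strictMono hlt) hq.2.2
      rw [he', he'] at this
      rw [abs_sub_comm, abs_of_pos (sub_pos.2 hlt), ← norm_neg]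
      convert this using 1
      congr 1
      module
    · simp [heq]
    · have := H _ _ hq.2.1 (e.symm.strictMono hlt) hq.1.2
      rw [he', he'] at this
      rwa [abs_of_pos (sub_pos.2 hlt)]
  obtain ⟨hder, hcont⟩ := exists_hasDerivAt_continuous_of_strict
    (β := fun s => α (e.symm s)) (u := fun s => u (e.symm s)) hstrict
  have hder' : ∀ s, HasDerivAt (fun s => α (e.symm (σ 0 + c * s)))
      (c • u (e.symm (σ 0 + c * s))) s := by
    intro s
    have h1 : HasDerivAt (fun s => σ 0 + c * s) c s := by
      simpa using ((hasDerivAt_id s).const_mul c).const_add (σ 0)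
    exact HasDerivAt.scomp (g₁ := fun s => α (e.symm s)) s (hder (σ 0 + c * s)) h1
  have hderiv : deriv (fun s => α (e.symm (σ 0 + c * s))) = fun s => c • u (e.symm (σ 0 + c * s)) :=
    funext fun s => (hder' s).deriv
  have hshift : ∀ s, e.symm (σ 0 + c * (s + 1)) = e.symm (σ 0 + c * s) + 1 := by
    intro s
    apply e.injective
    change σ _ = σ _
    rw [hσp, he', he']
    ring
  refine ⟨fun s => α (e.symm (σ 0 + c * s)), ⟨?_, ?_, ?_, ?_⟩, ?_⟩
  · rw [contDiff_one_iff_deriv, hderiv]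
    refine ⟨fun s => (hder' s).differentiableAt, ?_⟩
    exact (hcont.comp (by fun_prop : Continuous fun s => σ 0 + c * s)).const_smul c
  · intro s
    simp only
    rw [hshift, hper]
  · intro s hs t ht hst
    have hmem : ∀ s ∈ Set.Ico (0 : ℝ) 1, e.symm (σ 0 + c * s) ∈ Set.Ico (0 : ℝ) 1 := by
      intro s hs
      constructor
      · rw [← hσm.le_iff_le, he']
        nlinarith [hs.1]
      · rw [← hσm.lt_iff_lt, he']
        nlinarith [hs.2]
    have h1 := hmem s hs
    have h2 := hmem t ht
    have h3 := e.symm.injective (hinj _ _ hst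
      (by rw [abs_lt]; constructor <;> linarith [h1.1, h1.2, h2.1, h2.2]))
    exact mul_left_cancel₀ hc0.ne' (add_left_cancel h3)
  · intro s
    rw [hderiv]
    refine smul_ne_zero hc0.ne' fun h0 => ?_
    have := hu (e.symm (σ 0 + c * s))
    rw [h0, norm_zero] at this
    exact zero_ne_one this
  · ext p
    constructor
    · rintro ⟨t, rfl⟩
      refine ⟨(σ t - σ 0) / c, ?_⟩
      simp only
      rw [mul_div_cancel₀ _ hc0.ne', add_sub_cancel, he]
    · rintro ⟨s, rfl⟩
      exact ⟨_, rfl⟩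

/-- Main Theorem (plane case): `f ∈ Homeo¹(ℝ²)` iff (a) `f` maps every C¹ curve to a
C¹ curve, (b) `f` induces homeomorphisms `φ_p` of projective tangent spaces at every
point, and (c) the induced maps send every transverse sequence to a transverse sequence. -/
theorem main_theorem_plane (f : Plane ≃ₜ Plane) :
    InHomeo1 f ↔
      MapsC1 ⇑f ∧
      ∃ φ : Plane → (ProjLine ≃ₜ ProjLine),
        (∀ p : Plane, InducesAt ⇑f p (φ p)) ∧
        ∀ (p : Plane) (ℓ : ProjLine) (x : ℕ → Plane) (k : ℕ → ProjLine),
          TransverseFor p ℓ x k →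
            Transverse (fun n => f (x n)) (fun n => φ (x n) (k n)) := by
  constructor
  · intro hf
    obtain ⟨φ, hφ⟩ := hf.exists_projective_homeomorph
    refine ⟨hf.1, φ, fun p Γ ℓ hΓ => ?_, fun p ℓ x k hx => ⟨f p, φ p ℓ, ?_⟩⟩
    · have := TangentAt.image hf.1 hΓ (hφ p ℓ).1
      exact ⟨this.isC1Curve, this⟩
    · exact hf.transverseFor (φ := fun p => φ p) hφ hx
  · rintro ⟨hf, φ, hφ, htrans⟩
    have hline : ∀ p ℓ, Tendsto f (lineFilter p ℓ) (lineFilter (f p) (φ p ℓ)) := by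
      intro p ℓ
      obtain ⟨ℓ', hℓ'⟩ := hf.exists_lineFilter p ℓ
      obtain ⟨Γ, hΓ⟩ := exists_tangentAt p ℓ
      rwa [(hφ p Γ ℓ hΓ).2.unique (TangentAt.image hf hΓ hℓ')]
    refine ⟨hf, ?_⟩
    rintro _ ⟨γ, hγ, rfl⟩
    choose v hv hκ hright hleft using
      hf.exists_tangent_symm (φ := fun p => φ p) (fun p => (φ p).bijective) hline hγ
    have hα : HasContinuousTangentLine (fun t => f.symm (γ t)) v := by
      refine ⟨f.symm.continuous.comp hγ.1.continuous, hv, hright, hleft, ?_⟩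
      refine continuous_tangent_symm (f := f) (φ := fun p => φ p) htrans hγ hκ fun t => ?_
      rw [lineFilter_mk, ← nhdsLT_sup_nhdsGT, sup_comm]
      exact (hright t).sup_sup (hleft t)
    rw [← Set.range_comp]
    refine hα.isC1Curve_range (fun t => congrArg f.symm (hγ.2.1 t)) fun s t hst hlt => ?_
    exact hγ.eq_of_abs_sub_lt_one (f.symm.injective hst) hlt
end
end

section
/- Let f ∈ Homeo¹(ℝ²). Let α and β be simple closed C¹ curves in ℝ² intersecting at a point p that is an isolated point of α ∩ β, and suppose the intersection is one-sided, i.e. there is an open neighborhood U of p such that (β ∩ U) \ {p} is contained in a single connected component of U \ α. Then f(α) and f(β) have the same tangent line at f(p); in particular (taking f to be the identity) α and β have the same tangent line at p. -/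
open Filter Topology

noncomputable section

/-- If `g` is a closed `C¹` loop avoiding the open set `C`, the Cauchy integral
`∫ g' / (g - z)` has zero derivative in `z` at every point of `C`. -/
theorem hasDerivAt_cauchyIntegral_zero {g : ℝ → ℂ} (hg : ContDiff ℝ 1 g) {a b : ℝ}
    (hclosed : g a = g b) {C : Set ℂ} (hC : IsOpen C) (hgC : ∀ t, g t ∉ C) {z : ℂ}
    (hz : z ∈ C) :
    HasDerivAt (fun w => ∫ t in a..b, deriv g t / (g t - w)) 0 z := by
  have hg' : Continuous (deriv g) := hg.continuous_deriv le_rfl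
  have hne : ∀ w ∈ C, ∀ t, g t - w ≠ 0 := fun w hw t h =>
    hgC t (by rwa [sub_eq_zero.mp h])
  obtain ⟨ε, hε, hball⟩ := Metric.isOpen_iff.mp hC z hz
  have hball' : Metric.ball z (ε / 2) ⊆ C :=
    (Metric.ball_subset_ball (by linarith)).trans hball
  have hcont : ∀ w ∈ C, Continuous fun t => deriv g t / (g t - w) := fun w hw =>
    hg'.div (hg.continuous.sub continuous_const) (hne w hw)
  have hcont2 : ∀ w ∈ C, Continuous fun t => deriv g t / (g t - w) ^ 2 := fun w hw =>
    hg'.div ((hg.continuous.sub continuous_const).pow 2) fun t => pow_ne_zero 2 (hne w hw t)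
  have hlow : ∀ w ∈ Metric.ball z (ε / 2), ∀ t, ε / 2 ≤ ‖g t - w‖ := by
    intro w hw t
    by_contra! hlt
    refine hgC t (hball ?_)
    rw [Metric.mem_ball] at hw ⊢
    rw [← dist_eq_norm] at hlt
    linarith [dist_triangle (g t) w z]
  have key := (intervalIntegral.hasDerivAt_integral_of_dominated_loc_of_deriv_le
    (μ := MeasureTheory.volume) (𝕜 := ℂ)
    (F := fun w t => deriv g t / (g t - w)) (F' := fun w t => deriv g t / (g t - w) ^ 2)
    (x₀ := z) (a := a) (b := b) (s := Metric.ball z (ε / 2))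
    (bound := fun t => ‖deriv g t‖ / (ε / 2) ^ 2)
    (Metric.ball_mem_nhds z (by positivity))
    (by
      filter_upwards [Metric.ball_mem_nhds z (half_pos hε)] with w hw
      exact (hcont w (hball' hw)).aestronglyMeasurable)
    ((hcont z hz).intervalIntegrable _ _)
    (hcont2 z hz).aestronglyMeasurable
    (Eventually.of_forall fun t _ w hw => by
      rw [norm_div, norm_pow]
      gcongr
      exact hlow w hw t)
    ((hg'.norm.div_const _).intervalIntegrable _ _)
    (Eventually.of_forall fun t _ w hw => by
      have hw' := hne w (hball' hw) t
      have hd := (hasDerivAt_const w (deriv g t)).div ((hasDerivAt_id w).const_sub (g t)) hw'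
      exact hd.congr_deriv (by simp))).2
  have hprim : ∀ t ∈ Set.uIcc a b,
      HasDerivAt (fun t => -(g t - z)⁻¹) (deriv g t / (g t - z) ^ 2) t := by
    intro t _
    have hd := (((hg.differentiable one_ne_zero t).hasDerivAt.sub_const z).inv (hne z hz t)).neg
    exact hd.congr_deriv (by ring)
  rwa [intervalIntegral.integral_eq_sub_of_hasDerivAt hprim
    ((hcont2 z hz).intervalIntegrable _ _), hclosed, sub_self] at key

theorem abs_add_abs_le_mul_norm_sub {c : ℂ} (hc : c.im ≠ 0) :
    ∃ K > 0, ∀ t s : ℝ, |t| + |s| ≤ K * ‖(t : ℂ) - s * c‖ := by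
  have hc' : 0 < |c.im| := abs_pos.mpr hc
  refine ⟨1 + (‖c‖ + 1) / |c.im|, by positivity, fun t s => ?_⟩
  have h1 : |s| * |c.im| ≤ ‖(t : ℂ) - s * c‖ := by
    have := Complex.abs_im_le_norm ((t : ℂ) - s * c)
    simpa [abs_mul] using this
  have h2 : |t| ≤ ‖(t : ℂ) - s * c‖ + |s| * ‖c‖ := by
    have := norm_add_le ((t : ℂ) - s * c) (s * c)
    simpa using this
  have h3 : |s| ≤ ‖(t : ℂ) - s * c‖ / |c.im| := (le_div_iff₀ hc').mpr h1
  have h4 : |s| * (‖c‖ + 1) ≤ ‖(t : ℂ) - s * c‖ / |c.im| * (‖c‖ + 1) := by gcongr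
  calc |t| + |s| ≤ ‖(t : ℂ) - s * c‖ + |s| * (‖c‖ + 1) := by linarith
    _ ≤ ‖(t : ℂ) - s * c‖ + ‖(t : ℂ) - s * c‖ / |c.im| * (‖c‖ + 1) := by linarith
    _ = _ := by ring

/-- Two transverse arcs through `0` separate linearly. -/
theorem exists_le_norm_sub_of_transverse {g h : ℝ → ℂ} {c : ℂ} {r : ℝ}
    (hgc : Continuous g) (g0 : g 0 = 0) (hg : HasDerivAt g 1 0)
    (hne : ∀ t ∈ Set.Icc (-r) r, t ≠ 0 → g t ≠ 0)
    (h0 : h 0 = 0) (hh : HasDerivAt h c 0) (hc : c.im ≠ 0) :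
    ∃ κ > 0, ∀ᶠ s in 𝓝 (0 : ℝ), ∀ t ∈ Set.Icc (-r) r, κ * (|t| + |s|) ≤ ‖g t - h s‖ := by
  obtain ⟨K, hK, hKle⟩ := abs_add_abs_le_mul_norm_sub hc
  have hε : 0 < 1 / (2 * K) := by positivity
  have hg1 : ∀ᶠ t in 𝓝 (0 : ℝ), ‖g t - t‖ ≤ 1 / (2 * K) * |t| := by
    have := (hasDerivAt_iff_isLittleO.mp hg).def hε
    simpa [g0] using this
  have hh1 : ∀ᶠ s in 𝓝 (0 : ℝ), ‖h s - s * c‖ ≤ 1 / (2 * K) * |s| := by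
    have := (hasDerivAt_iff_isLittleO.mp hh).def hε
    simpa [h0] using this
  obtain ⟨δ, hδ, hδg⟩ := Metric.eventually_nhds_iff.mp hg1
  obtain ⟨m, hm, hmle⟩ : ∃ m > 0, ∀ t ∈ Set.Icc (-r) r, δ ≤ |t| → m ≤ ‖g t‖ := by
    have hcpt : IsCompact (Set.Icc (-r) r ∩ {t | δ ≤ |t|}) :=
      isCompact_Icc.inter_right (isClosed_le continuous_const continuous_abs)
    rcases (Set.Icc (-r) r ∩ {t | δ ≤ |t|}).eq_empty_or_nonempty with he | hn
    · refine ⟨1, one_pos, fun t ht hdt => ?_⟩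
      have : t ∈ Set.Icc (-r) r ∩ {t | δ ≤ |t|} := ⟨ht, hdt⟩
      simp [he] at this
    · obtain ⟨t₀, ht₀, hmin⟩ := hcpt.exists_isMinOn hn hgc.norm.continuousOn
      refine ⟨‖g t₀‖, norm_pos_iff.mpr (hne t₀ ht₀.1 ?_), fun t ht hdt => hmin ⟨ht, hdt⟩⟩
      exact abs_pos.mp (hδ.trans_le ht₀.2)
  have hhc : ∀ᶠ s in 𝓝 (0 : ℝ), ‖h s‖ < m / 2 := by
    have := hh.continuousAt.norm
    refine this.eventually_lt_const ?_
    simpa [h0] using hm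
  have hs1 : ∀ᶠ s in 𝓝 (0 : ℝ), |s| < 1 :=
    continuous_abs.continuousAt.eventually_lt_const (by simp)
  refine ⟨min (1 / (2 * K)) (m / 2 / (|r| + 1)), by positivity, ?_⟩
  filter_upwards [hh1, hhc, hs1] with s hs hsm hs1 t ht
  by_cases htδ : |t| < δ
  · have ht' := hδg (y := t) (by simpa using htδ)
    have hlin : 1 / K * (|t| + |s|) ≤ ‖(t : ℂ) - s * c‖ := by
      rw [one_div, inv_mul_le_iff₀ hK]
      exact hKle t s
    have htri : ‖(t : ℂ) - s * c‖ ≤ ‖g t - h s‖ + ‖g t - t‖ + ‖h s - s * c‖ := by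
      have e : (t : ℂ) - s * c = (g t - h s) - (g t - t) + (h s - s * c) := by ring
      rw [e]
      exact (norm_add_le _ _).trans (by gcongr; exact norm_sub_le _ _)
    have e : 1 / K * (|t| + |s|) = 2 * (1 / (2 * K) * (|t| + |s|)) := by field_simp
    calc _ ≤ 1 / (2 * K) * (|t| + |s|) := by gcongr; exact min_le_left _ _
      _ ≤ _ := by linarith
  · have hgm := hmle t ht (not_lt.mp htδ)
    have htr : |t| ≤ |r| := (abs_le.mpr ht).trans (le_abs_self r)
    calc _ ≤ m / 2 / (|r| + 1) * (|r| + 1) := by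
          gcongr
          exact min_le_right _ _
      _ = m / 2 := by field_simp
      _ ≤ ‖g t‖ - ‖h s‖ := by linarith
      _ ≤ _ := norm_sub_norm_le _ _

/-- The integral over the real line of the difference of the Cauchy kernels at `c` and `-c`. -/
theorem integral_cauchy_jump_ne_zero {c : ℂ} (hc : c.im ≠ 0)
    (hint : MeasureTheory.Integrable fun x : ℝ => 2 * c / (((x : ℂ) - c) * (x + c))) :
    ∫ x : ℝ, 2 * c / (((x : ℂ) - c) * (x + c)) ≠ 0 := by
  have hpos : ∀ x : ℝ, 0 < (2 * c / (((x : ℂ) - c) * (x + c))).im * c.im := by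
    intro x
    have hd : ((x : ℂ) - c) * (x + c) ≠ 0 := by
      refine mul_ne_zero (fun h => hc ?_) (fun h => hc ?_)
      · simpa using congrArg Complex.im h
      · simpa using congrArg Complex.im h
    have hn := Complex.normSq_pos.mpr hd
    have e : (2 * c / (((x : ℂ) - c) * (x + c))).im * c.im =
        2 * c.im ^ 2 * (x ^ 2 + c.re ^ 2 + c.im ^ 2) /
          Complex.normSq (((x : ℂ) - c) * (x + c)) := by
      rw [Complex.div_im]
      field_simp
      simp
      ring
    rw [e]
    positivity
  intro h0
  have him : ∫ x : ℝ, (2 * c / (((x : ℂ) - c) * (x + c))).im = 0 := by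
    have := Complex.imCLM.integral_comp_comm hint
    simpa [h0] using this
  have hint' : MeasureTheory.Integrable
      fun x : ℝ => (2 * c / (((x : ℂ) - c) * (x + c))).im * c.im := hint.im.mul_const _
  have := (MeasureTheory.integral_pos_iff_support_of_nonneg (fun x => (hpos x).le) hint').mpr (by
    have : Function.support (fun x : ℝ => (2 * c / (((x : ℂ) - c) * (x + c))).im * c.im) =
        Set.univ := Set.eq_univ_of_forall fun x => (hpos x).ne'
    rw [this]
    simp)
  rw [MeasureTheory.integral_mul_const, him, zero_mul] at this
  exact this.false

/-- Points of an arc on opposite sides of a closed `C¹` loop that it meets transversally do not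
lie in a common connected open set avoiding the loop. -/
theorem not_mem_connected_of_transverse {g h : ℝ → ℂ} {c : ℂ} {r : ℝ} (hr : 0 < r)
    (hg : ContDiff ℝ 1 g) (g0 : g 0 = 0) (hg0 : HasDerivAt g 1 0) (hclosed : g (-r) = g r)
    (hne : ∀ t ∈ Set.Icc (-r) r, t ≠ 0 → g t ≠ 0)
    (h0 : h 0 = 0) (hh : HasDerivAt h c 0) (hc : c.im ≠ 0)
    {C : Set ℂ} (hCo : IsOpen C) (hC : IsPreconnected C) (hgC : ∀ t, g t ∉ C)
    (hhC : ∀ᶠ s in 𝓝[>] (0 : ℝ), h s ∈ C ∧ h (-s) ∈ C) : False := by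
  have hg' : Continuous (deriv g) := hg.continuous_deriv le_rfl
  obtain ⟨κ, hκ, hlow⟩ := exists_le_norm_sub_of_transverse hg.continuous g0 hg0 hne h0 hh hc
  have hlow' : ∀ᶠ s in 𝓝 (0 : ℝ), ∀ t ∈ Set.Icc (-r) r, κ * (|t| + |s|) ≤ ‖g t - h (-s)‖ := by
    have : Tendsto (fun s : ℝ => -s) (𝓝 0) (𝓝 0) := by
      simpa using (continuous_neg (G := ℝ)).tendsto 0
    filter_upwards [this.eventually hlow] with s hs t ht
    simpa using hs t ht
  obtain ⟨M, hM⟩ := (isCompact_Icc (a := -r) (b := r)).exists_bound_of_continuousOn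
    hg'.continuousOn
  have hM0 : 0 ≤ M := (norm_nonneg _).trans (hM 0 ⟨by linarith, hr.le⟩)
  have hslope : Tendsto (fun s : ℝ => h s / s) (𝓝[>] 0) (𝓝 c) := by
    have := (hasDerivAt_iff_tendsto_slope_zero.mp hh).mono_left
      (nhdsWithin_mono (0 : ℝ) fun x (hx : 0 < x) => hx.ne')
    refine this.congr fun s => ?_
    simp [h0, div_eq_inv_mul]
  have hslope' : Tendsto (fun s : ℝ => h (-s) / s) (𝓝[>] 0) (𝓝 (-c)) := by
    have hneg : HasDerivAt (fun s => h (-s)) (-c) 0 := by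
      have := HasDerivAt.scomp (0 : ℝ) (g₁ := h) (h := fun s : ℝ => -s) (by simpa using hh)
        (hasDerivAt_neg (0 : ℝ))
      simpa [Function.comp_def] using this
    have := (hasDerivAt_iff_tendsto_slope_zero.mp hneg).mono_left
      (nhdsWithin_mono (0 : ℝ) fun x (hx : 0 < x) => hx.ne')
    refine this.congr fun s => ?_
    simp [h0, div_eq_inv_mul]
  let G : ℝ → ℝ → ℂ := fun s t => deriv g t / (g t - h s) - deriv g t / (g t - h (-s))
  let F : ℝ → ℝ → ℂ := fun s x => (s : ℂ) * (Set.Ioc (-r) r).indicator (G s) (s * x)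
  have hGeq : ∀ᶠ s in 𝓝[>] (0 : ℝ), ∀ t,
      G s t = deriv g t * (h s - h (-s)) / ((g t - h s) * (g t - h (-s))) := by
    filter_upwards [hhC] with s hs t
    have h1 : g t - h s ≠ 0 := fun e => hgC t (by rw [sub_eq_zero.mp e]; exact hs.1)
    have h2 : g t - h (-s) ≠ 0 := fun e => hgC t (by rw [sub_eq_zero.mp e]; exact hs.2)
    simp only [G]
    field_simp
    ring
  have hGcont : ∀ᶠ s in 𝓝[>] (0 : ℝ), Continuous (G s) := by
    filter_upwards [hhC] with s hs
    refine (hg'.div (hg.continuous.sub continuous_const) fun t e => hgC t ?_).sub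
      (hg'.div (hg.continuous.sub continuous_const) fun t e => hgC t ?_)
    · rw [sub_eq_zero.mp e]; exact hs.1
    · rw [sub_eq_zero.mp e]; exact hs.2
  have hFzero : ∀ᶠ s in 𝓝[>] (0 : ℝ), ∫ x, F s x = 0 := by
    filter_upwards [hhC, hGcont] with s hs hGs
    have hconst := hCo.is_const_of_deriv_eq_zero hC
      (f := fun w => ∫ t in (-r)..r, deriv g t / (g t - w))
      (fun w hw => (hasDerivAt_cauchyIntegral_zero hg hclosed hCo hgC
        hw).differentiableAt.differentiableWithinAt)
      (fun w hw => (hasDerivAt_cauchyIntegral_zero hg hclosed hCo hgC hw).deriv)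
      hs.1 hs.2
    have hI : ∫ t in (-r)..r, G s t = 0 := by
      have hii : ∀ w ∈ C, IntervalIntegrable (fun t => deriv g t / (g t - w))
          MeasureTheory.volume (-r) r := fun w hw =>
        (hg'.div (hg.continuous.sub continuous_const) fun t e =>
          hgC t (by rw [sub_eq_zero.mp e]; exact hw)).intervalIntegrable _ _
      simp only [G]
      rw [intervalIntegral.integral_sub (hii _ hs.1) (hii _ hs.2), sub_eq_zero]
      exact hconst
    simp only [F]
    rw [MeasureTheory.integral_const_mul,
      MeasureTheory.Measure.integral_comp_mul_left ((Set.Ioc (-r) r).indicator (G s)) s,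
      MeasureTheory.integral_indicator measurableSet_Ioc,
      ← intervalIntegral.integral_of_le (by linarith), hI]
    simp
  have hbdslope : ∀ᶠ s in 𝓝[>] (0 : ℝ), ‖(h s - h (-s)) / s‖ < ‖c - -c‖ + 1 := by
    have := (hslope.sub hslope').norm.eventually_lt_const (lt_add_one _)
    filter_upwards [this] with s hs
    rwa [sub_div]
  have hbound : ∀ᶠ s in 𝓝[>] (0 : ℝ), ∀ x : ℝ,
      ‖F s x‖ ≤ M * (‖c - -c‖ + 1) / κ ^ 2 * (1 + x ^ 2)⁻¹ := by
    filter_upwards [hGeq, hbdslope, nhdsWithin_le_nhds hlow, nhdsWithin_le_nhds hlow',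
      self_mem_nhdsWithin] with s hGs hsl hl hl' (hs : 0 < s)
    intro x
    simp only [F]
    by_cases hx : s * x ∈ Set.Ioc (-r) r
    · have hx' := Set.Ioc_subset_Icc_self hx
      have e : κ * (|s * x| + |s|) = κ * s * (1 + |x|) := by
        rw [abs_mul, abs_of_pos hs]; ring
      have l1 := hl _ hx'
      have l2 := hl' _ hx'
      rw [e] at l1 l2
      rw [Set.indicator_of_mem hx, hGs, norm_mul, norm_div, norm_mul, norm_mul,
        Complex.norm_real, Real.norm_of_nonneg hs.le]
      have hsl' : ‖h s - h (-s)‖ ≤ (‖c - -c‖ + 1) * s := by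
        rw [norm_div, Complex.norm_real, Real.norm_of_nonneg hs.le, div_lt_iff₀ hs] at hsl
        exact hsl.le
      calc s * (‖deriv g (s * x)‖ * ‖h s - h (-s)‖ /
            (‖g (s * x) - h s‖ * ‖g (s * x) - h (-s)‖))
          ≤ s * (M * ((‖c - -c‖ + 1) * s) / ((κ * s * (1 + |x|)) * (κ * s * (1 + |x|)))) := by
            gcongr
            exact hM _ hx'
        _ = M * (‖c - -c‖ + 1) / κ ^ 2 * ((1 + |x|) ^ 2)⁻¹ := by field_simp
        _ ≤ _ := by
            gcongr
            nlinarith [abs_nonneg x, sq_abs x]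
    · rw [Set.indicator_of_notMem hx]
      simp only [mul_zero, norm_zero]
      positivity
  have hlim : ∀ x : ℝ,
      Tendsto (fun s => F s x) (𝓝[>] 0) (𝓝 (2 * c / (((x : ℂ) - c) * (x + c)))) := by
    intro x
    have hsx : Tendsto (fun s : ℝ => s * x) (𝓝[>] 0) (𝓝 0) := by
      have : Tendsto (fun s : ℝ => s * x) (𝓝 0) (𝓝 (0 * x)) :=
        (continuous_id.mul continuous_const).tendsto 0
      rw [zero_mul] at this
      exact this.mono_left nhdsWithin_le_nhds
    have hgd : Tendsto (fun s : ℝ => deriv g (s * x)) (𝓝[>] 0) (𝓝 1) := by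
      have := (hg'.tendsto 0).comp hsx
      rwa [hg0.deriv] at this
    have hgs : Tendsto (fun s : ℝ => g (s * x) / s) (𝓝[>] 0) (𝓝 x) := by
      have hd : HasDerivAt (fun s : ℝ => g (s * x)) (x : ℂ) 0 := by
        have := HasDerivAt.scomp (0 : ℝ) (g₁ := g) (h := fun s : ℝ => s * x) (by simpa using hg0)
          ((hasDerivAt_id (0 : ℝ)).mul_const x)
        simpa [Function.comp_def] using this
      have := (hasDerivAt_iff_tendsto_slope_zero.mp hd).mono_left
        (nhdsWithin_mono (0 : ℝ) fun x (hx : 0 < x) => hx.ne')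
      refine this.congr fun s => ?_
      simp [g0, div_eq_inv_mul]
    have hd : ((x : ℂ) - c) * (x - -c) ≠ 0 := by
      refine mul_ne_zero (fun h => hc ?_) (fun h => hc ?_)
      · simpa using congrArg Complex.im h
      · simpa using congrArg Complex.im h
    have hmain := (hgd.mul (hslope.sub hslope')).div ((hgs.sub hslope).mul (hgs.sub hslope')) hd
    have e : 1 * (c - -c) / (((x : ℂ) - c) * (x - -c)) = 2 * c / (((x : ℂ) - c) * (x + c)) := by
      rw [sub_neg_eq_add, sub_neg_eq_add]; ring
    rw [e] at hmain
    refine hmain.congr' ?_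
    filter_upwards [hGeq, hsx.eventually (Ioc_mem_nhds (neg_lt_zero.mpr hr) hr),
      self_mem_nhdsWithin] with s hGs hx (hs : 0 < s)
    have hs' : (s : ℂ) ≠ 0 := by exact_mod_cast hs.ne'
    simp only [F, Pi.div_apply]
    rw [Set.indicator_of_mem (show s * x ∈ Set.Ioc (-r) r from hx), hGs, ← sub_div, ← sub_div,
      ← sub_div]
    field_simp
  have hdom : MeasureTheory.Integrable
      fun x : ℝ => M * (‖c - -c‖ + 1) / κ ^ 2 * (1 + x ^ 2)⁻¹ :=
    integrable_inv_one_add_sq.const_mul _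
  have hmeas : ∀ᶠ s in 𝓝[>] (0 : ℝ),
      MeasureTheory.AEStronglyMeasurable (F s) MeasureTheory.volume := by
    filter_upwards [hGcont] with s hs
    refine Measurable.aestronglyMeasurable ?_
    exact ((hs.measurable.indicator measurableSet_Ioc).comp (measurable_const_mul s)).const_mul _
  have htend := MeasureTheory.tendsto_integral_filter_of_dominated_convergence _ hmeas
    (hbound.mono fun s hs => Eventually.of_forall hs) hdom
    (Eventually.of_forall hlim)
  refine integral_cauchy_jump_ne_zero hc ?_
    (tendsto_nhds_unique htend (tendsto_const_nhds.congr' (hFzero.mono fun s hs => hs.symm)))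
  refine hdom.mono' (Measurable.aestronglyMeasurable (by fun_prop))
    (Eventually.of_forall fun x => ?_)
  exact le_of_tendsto (hlim x).norm (hbound.mono fun s hs => hs x)

theorem IsRegParam.apply_ne_of_abs_lt_one {γ : ℝ → Plane} (hγ : IsRegParam γ) {t u : ℝ}
    (hne : u ≠ t) (hlt : |u - t| < 1) : γ u ≠ γ t := by
  intro h
  have hfr : ∀ s, γ (Int.fract s) = γ s := fun s => by
    have := hγ.2.1.sub_int_mul_eq (x := s) ⌊s⌋
    rwa [mul_one] at this
  have := hγ.2.2.1 ⟨Int.fract_nonneg u, Int.fract_lt_one u⟩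
    ⟨Int.fract_nonneg t, Int.fract_lt_one t⟩ (by rw [hfr, hfr, h])
  obtain ⟨z, hz⟩ := Int.fract_eq_fract.mp this
  rw [hz] at hlt
  have hz0 : z = 0 := by
    have : |z| < 1 := by exact_mod_cast hlt
    exact Int.abs_lt_one_iff.mp this
  rw [hz0, Int.cast_zero, sub_eq_zero] at hz
  exact hne hz

/-- If the punctured germ of `b` at `u₀` stays in a connected open set avoiding the curve
parameterized by `a`, then `a` and `b` have proportional derivatives at their common point. -/
theorem IsRegParam.mk_deriv_eq_of_one_sided {a b : ℝ → Plane} (ha : IsRegParam a)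
    (hb : IsRegParam b) {t₀ u₀ : ℝ} (hab : a t₀ = b u₀) {C : Set Plane} (hCo : IsOpen C)
    (hC : IsPreconnected C) (haC : ∀ t, a t ∉ C) (hbC : ∀ᶠ u in 𝓝[≠] u₀, b u ∈ C) :
    Projectivization.mk ℝ (deriv a t₀) (ha.2.2.2 t₀) =
      Projectivization.mk ℝ (deriv b u₀) (hb.2.2.2 u₀) := by
  let e : Plane ≃L[ℝ] ℂ := Complex.equivRealProdCLM.symm
  have hv : e (deriv a t₀) ≠ 0 := e.map_ne_zero_iff.mpr (ha.2.2.2 t₀)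
  set v := e (deriv a t₀) with hvdef
  let Φ : Plane ≃ₜ ℂ := ((Homeomorph.subRight (a t₀)).trans e.toHomeomorph).trans
    (Homeomorph.mulRight₀ v⁻¹ (inv_ne_zero hv))
  have hΦ : ∀ x, Φ x = e (x - a t₀) * v⁻¹ := fun x => rfl
  have hderiv : ∀ {γ : ℝ → Plane} (hγ : IsRegParam γ) (w : ℝ),
      HasDerivAt (fun t => Φ (γ (w + t))) (e (deriv γ w) * v⁻¹) 0 := by
    intro γ hγ w
    have h1 : HasDerivAt γ (deriv γ w) (w + 0) := by
      rw [add_zero]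
      exact (hγ.1.differentiable one_ne_zero w).hasDerivAt
    have h2 := (h1.comp_const_add w 0).sub_const (a t₀)
    exact (e.hasFDerivAt.comp_hasDerivAt (0 : ℝ) h2).mul_const v⁻¹
  by_cases hc : (e (deriv b u₀) * v⁻¹).im = 0
  · have hr : e (deriv b u₀) = ((e (deriv b u₀) * v⁻¹).re : ℂ) * v := by
      have : ((e (deriv b u₀) * v⁻¹).re : ℂ) = e (deriv b u₀) * v⁻¹ :=
        Complex.ext (by simp) (by simpa using hc.symm)
      rw [this, inv_mul_cancel_right₀ hv]
    refine Eq.symm ((Projectivization.mk_eq_mk_iff' ℝ _ _ _ _).mpr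
      ⟨(e (deriv b u₀) * v⁻¹).re, ?_⟩)
    apply e.injective
    rw [map_smul, ← hvdef, Complex.real_smul, ← hr]
  · exfalso
    refine not_mem_connected_of_transverse (g := fun t => Φ (a (t₀ + t)))
      (h := fun u => Φ (b (u₀ + u))) (r := 1 / 2) (C := Φ '' C) (by norm_num) ?_ ?_ ?_ ?_ ?_ ?_
      (hderiv hb u₀) hc (Φ.isOpenMap _ hCo) (hC.image _ Φ.continuous.continuousOn) ?_ ?_
    · simp only [hΦ]
      exact (e.contDiff.comp ((ha.1.comp (contDiff_const.add contDiff_id)).sub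
        contDiff_const)).mul contDiff_const
    · simp [hΦ]
    · have := hderiv ha t₀
      rwa [← hvdef, mul_inv_cancel₀ hv] at this
    · have := ha.2.1 (t₀ + -(1 / 2))
      rw [← this]
      congr 2
      ring
    · intro t ht ht0 h
      refine ha.apply_ne_of_abs_lt_one (t := t₀) (u := t₀ + t) (by simpa using ht0) ?_ ?_
      · rw [add_sub_cancel_left]
        exact (abs_le.mpr ht).trans_lt (by norm_num)
      · apply Φ.injective
        rw [h, hΦ (a t₀)]
        simp
    · simp [hΦ, hab]
    · rintro t ⟨x, hx, hxt⟩
      exact haC _ (Φ.injective hxt ▸ hx)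
    · have hplus : Tendsto (fun s : ℝ => u₀ + s) (𝓝[≠] 0) (𝓝[≠] u₀) := by
        refine tendsto_nhdsWithin_iff.mpr ⟨?_, ?_⟩
        · have : Tendsto (fun s : ℝ => u₀ + s) (𝓝 0) (𝓝 (u₀ + 0)) :=
            (continuous_const.add continuous_id).tendsto 0
          rw [add_zero] at this
          exact this.mono_left nhdsWithin_le_nhds
        · filter_upwards [self_mem_nhdsWithin] with s hs
          simpa using hs
      have hbC' := hplus.eventually hbC
      rw [eventually_nhdsWithin_iff] at hbC'
      have hneg : Tendsto (fun s : ℝ => -s) (𝓝 0) (𝓝 0) := by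
        simpa using (continuous_neg (G := ℝ)).tendsto 0
      filter_upwards [nhdsWithin_le_nhds hbC', nhdsWithin_le_nhds (hneg.eventually hbC'),
        self_mem_nhdsWithin] with s h1 h2 (hs : 0 < s)
      exact ⟨⟨_, h1 hs.ne', rfl⟩, ⟨_, h2 (neg_ne_zero.mpr hs.ne'), rfl⟩⟩

/-- One-sided isolated intersections: if `α` and `β` intersect at an isolated point
`p` of `α ∩ β` with a one-sided intersection, then `f(α)` and `f(β)` have the same
tangent line at `f(p)` for any `f ∈ Homeo¹(ℝ²)` (in particular, taking `f = id`,
`α` and `β` have the same tangent line at `p`). -/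
theorem one_sided_isolated_same_tangent (f : Plane ≃ₜ Plane) (hf : InHomeo1 f)
    (α β : Set Plane) (hα : IsC1Curve α) (hβ : IsC1Curve β)
    (p : Plane) (hp : p ∈ α ∩ β)
    (hiso : ∃ U ∈ 𝓝 p, α ∩ β ∩ U = {p})
    (honesided : ∃ U : Set Plane, IsOpen U ∧ p ∈ U ∧
      ∃ x ∈ U \ α, (β ∩ U) \ {p} ⊆ connectedComponentIn (U \ α) x) :
    ∃ ℓ' : ProjLine, TangentAt (⇑f '' α) (f p) ℓ' ∧ TangentAt (⇑f '' β) (f p) ℓ' := by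
  obtain ⟨U, hU, hpU, x, -, hsub⟩ := honesided
  obtain ⟨a, ha, haR⟩ := hf.1 α hα
  obtain ⟨b, hb, hbR⟩ := hf.1 β hβ
  obtain ⟨t₀, ht₀⟩ : f p ∈ Set.range a := haR ▸ Set.mem_image_of_mem f hp.1
  obtain ⟨u₀, hu₀⟩ : f p ∈ Set.range b := hbR ▸ Set.mem_image_of_mem f hp.2
  have hαc : IsClosed α := by
    obtain ⟨γ, hγ, rfl⟩ := hα
    have hcpt := (isCompact_Icc (a := (0 : ℝ)) (b := 0 + 1)).image hγ.1.continuous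
    rw [hγ.2.1.image_Icc one_pos] at hcpt
    exact hcpt.isClosed
  have hmk := ha.mk_deriv_eq_of_one_sided hb (ht₀.trans hu₀.symm)
    (C := f '' connectedComponentIn (U \ α) x)
    (f.isOpenMap _ (hU.sdiff hαc).connectedComponentIn)
    (isPreconnected_connectedComponentIn.image _ f.continuous.continuousOn)
    (by
      rintro t ⟨y, hy, hyt⟩
      obtain ⟨z, hz, hzt⟩ : a t ∈ f '' α := haR ▸ Set.mem_range_self t
      have hyz : y = z := f.injective (hyt.trans hzt.symm)
      exact (connectedComponentIn_subset _ _ hy).2 (hyz ▸ hz))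
    (by
      have hfU : f '' U ∈ 𝓝 (b u₀) :=
        (f.isOpenMap _ hU).mem_nhds (hu₀ ▸ Set.mem_image_of_mem f hpU)
      have hne : ∀ᶠ u in 𝓝[≠] u₀, b u ≠ b u₀ :=
        (hb.1.differentiable one_ne_zero u₀).hasDerivAt.eventually_ne (hb.2.2.2 u₀)
      filter_upwards [nhdsWithin_le_nhds (hb.1.continuous.continuousAt hfU), hne] with u hu hun
      obtain ⟨y, hy, hyu⟩ := hu
      obtain ⟨z, hz, hzu⟩ : b u ∈ f '' β := hbR ▸ Set.mem_range_self u
      have hyz : y = z := f.injective (hyu.trans hzu.symm)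
      refine ⟨y, hsub ⟨⟨hyz ▸ hz, hy⟩, fun hyp => hun ?_⟩, hyu⟩
      rw [← hyu, Set.mem_singleton_iff.mp hyp, hu₀])
  exact ⟨_, ⟨a, t₀, ha, haR, ht₀, rfl⟩, ⟨b, u₀, hb, hbR, hu₀, hmk⟩⟩
end
end

section
/- Let α, β : ℝ → ℝ² be injective continuously differentiable maps with nowhere-vanishing derivative such that α(0) = β(0) = 0 ∈ ℝ². Suppose there exist sequences of nonzero reals (tₙ) and (sₙ) with tₙ → 0 and sₙ → 0 such that the points α(tₙ) = β(sₙ) are nonzero and pairwise distinct. Then there exists a nonzero real number C such that α'(0) = C • β'(0); in particular the reparameterization t ↦ β(C t) is an injective C¹ map with nowhere-vanishing derivative whose derivative at 0 equals α'(0) ≠ 0. -/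
open Filter Topology

noncomputable section

/-- The slopes `(t n)⁻¹ • γ (t n)` of a curve with `γ 0 = 0` converge to its derivative at `0`. -/
lemma tendsto_inv_smul_of_hasDerivAt_zero {E : Type*} [NormedAddCommGroup E] [NormedSpace ℝ E]
    {γ : ℝ → E} {v : E} (hγ : HasDerivAt γ v 0) (hγ0 : γ 0 = 0) {t : ℕ → ℝ}
    (ht0 : ∀ n, t n ≠ 0) (ht : Tendsto t atTop (𝓝 0)) :
    Tendsto (fun n => (t n)⁻¹ • γ (t n)) atTop (𝓝 v) := by
  have h := hasDerivAt_iff_tendsto_slope.mp hγ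
  have ht' : Tendsto t atTop (𝓝[≠] 0) :=
    tendsto_nhdsWithin_iff.mpr ⟨ht, Eventually.of_forall ht0⟩
  simpa [Function.comp_def, slope_def_module, hγ0] using h.comp ht'

/-- Curves through the origin that agree along parameters tending to `0` have parallel
derivatives at `0`. -/
lemma cross_eq_of_frequent_intersections {α β : ℝ → ℝ × ℝ} {a b : ℝ × ℝ}
    (hα : HasDerivAt α a 0) (hβ : HasDerivAt β b 0) (hα0 : α 0 = 0) (hβ0 : β 0 = 0)
    {t s : ℕ → ℝ} (ht0 : ∀ n, t n ≠ 0) (hs0 : ∀ n, s n ≠ 0)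
    (ht : Tendsto t atTop (𝓝 0)) (hs : Tendsto s atTop (𝓝 0))
    (heq : ∀ n, α (t n) = β (s n)) :
    a.1 * b.2 = a.2 * b.1 := by
  have hA := tendsto_inv_smul_of_hasDerivAt_zero hα hα0 ht0 ht
  have hB := tendsto_inv_smul_of_hasDerivAt_zero hβ hβ0 hs0 hs
  refine tendsto_nhds_unique (hA.fst_nhds.mul hB.snd_nhds) ?_
  refine (hA.snd_nhds.mul hB.fst_nhds).congr fun n => ?_
  simp only [heq, Prod.smul_fst, Prod.smul_snd, smul_eq_mul]
  ring

/-- Parallel nonzero vectors of the plane are nonzero multiples of each other. -/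
lemma exists_ne_zero_smul_eq_of_cross_eq {a b : ℝ × ℝ} (ha : a ≠ 0) (hb : b ≠ 0)
    (h : a.1 * b.2 = a.2 * b.1) : ∃ C : ℝ, C ≠ 0 ∧ a = C • b := by
  obtain ⟨C, hC⟩ : ∃ C : ℝ, a = C • b := by
    by_cases hb1 : b.1 = 0
    · have hb2 : b.2 ≠ 0 := fun hb2 => hb (Prod.ext hb1 hb2)
      have ha1 : a.1 = 0 := by simpa [hb1, hb2] using h
      exact ⟨a.2 / b.2, Prod.ext (by simp [ha1, hb1]) (by simp [hb2])⟩
    · refine ⟨a.1 / b.1, Prod.ext (by simp [hb1]) ?_⟩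
      simp only [Prod.smul_snd, smul_eq_mul]
      field_simp
      exact h.symm
  refine ⟨C, ?_, hC⟩
  rintro rfl
  exact ha (by simpa using hC)

/-- Two injective regular C¹ arcs through the origin meeting in infinitely many distinct
points accumulating at the origin have proportional (nonzero) derivatives at `0`;
in particular `β` can be linearly reparameterized to have derivative `α'(0) ≠ 0` at `0`. -/
theorem infinite_intersections_share_tangent (α β : ℝ → Plane)
    (hαc : ContDiff ℝ 1 α) (hβc : ContDiff ℝ 1 β)
    (hαinj : Function.Injective α) (hβinj : Function.Injective β)
    (hαd : ∀ t, deriv α t ≠ 0) (hβd : ∀ t, deriv β t ≠ 0)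
    (hα0 : α 0 = 0) (hβ0 : β 0 = 0)
    (t s : ℕ → ℝ) (ht0 : ∀ n, t n ≠ 0) (hs0 : ∀ n, s n ≠ 0)
    (htlim : Tendsto t atTop (𝓝 0)) (hslim : Tendsto s atTop (𝓝 0))
    (heq : ∀ n, α (t n) = β (s n))
    (hne : ∀ n, α (t n) ≠ 0)
    (hdist : ∀ m n, m ≠ n → α (t m) ≠ α (t n)) :
    ∃ C : ℝ, C ≠ 0 ∧ deriv α 0 = C • deriv β 0 ∧
      Function.Injective (fun u : ℝ => β (C * u)) ∧
      ContDiff ℝ 1 (fun u : ℝ => β (C * u)) ∧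
      (∀ u : ℝ, deriv (fun u : ℝ => β (C * u)) u ≠ 0) ∧
      deriv (fun u : ℝ => β (C * u)) 0 = deriv α 0 ∧ deriv α 0 ≠ 0 := by
  have hα : HasDerivAt α (deriv α 0) 0 :=
    (hαc.differentiable one_ne_zero 0).hasDerivAt
  have hβ : ∀ u, HasDerivAt β (deriv β u) u := fun u =>
    (hβc.differentiable one_ne_zero u).hasDerivAt
  obtain ⟨C, hC0, hC⟩ := exists_ne_zero_smul_eq_of_cross_eq (hαd 0) (hβd 0)
    (cross_eq_of_frequent_intersections hα (hβ 0) hα0 hβ0 ht0 hs0 htlim hslim heq)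
  have hderiv : ∀ u, deriv (fun u : ℝ => β (C * u)) u = C • deriv β (C * u) :=
    fun u => deriv_comp_mul_left C β u
  refine ⟨C, hC0, hC, hβinj.comp (mul_right_injective₀ hC0),
    hβc.comp (contDiff_const.mul contDiff_id), fun u => ?_, ?_, hαd 0⟩
  · rw [hderiv]
    exact smul_ne_zero hC0 (hβd _)
  · rw [hderiv, mul_zero, hC]
end
end

section
/- Let Γ₁ and Γ₂ be simple closed C¹ curves in ℝ², and suppose (pₙ) is a sequence of pairwise distinct points of Γ₁ ∩ Γ₂ converging to a point p. Then p ∈ Γ₁ ∩ Γ₂ and Γ₁ and Γ₂ have the same tangent line at p. -/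
open Filter Topology

noncomputable section

/-- A sequence on a curve converging to `p ≠ x n` has a subsequence whose suitably rescaled
secant vectors at `p` converge to the velocity of the curve at a parameter of `p`. -/
theorem IsRegParam.exists_subseq_secant_tendsto {γ : ℝ → Plane} (hγ : IsRegParam γ)
    {x : ℕ → Plane} {p : Plane} (hx : ∀ n, x n ∈ Set.range γ) (hne : ∀ n, x n ≠ p)
    (hlim : Tendsto x atTop (𝓝 p)) :
    ∃ (t₀ : ℝ) (φ : ℕ → ℕ) (c : ℕ → ℝ), γ t₀ = p ∧ StrictMono φ ∧
      Tendsto (fun n => c n • (x (φ n) - p)) atTop (𝓝 (deriv γ t₀)) := by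
  obtain ⟨hC, hper, -, -⟩ := hγ
  have hparam : ∀ n, ∃ t ∈ Set.Icc (0 : ℝ) 1, γ t = x n := by
    intro n
    obtain ⟨s, hs⟩ := hx n
    obtain ⟨t, ht, hst⟩ := hper.exists_mem_Ico₀ one_pos s
    exact ⟨t, Set.Ico_subset_Icc_self ht, hst.symm.trans hs⟩
  choose t ht htx using hparam
  obtain ⟨t₀, -, φ, hφ, htt⟩ := isCompact_Icc.tendsto_subseq ht
  have hp : γ t₀ = p := by
    refine tendsto_nhds_unique ((hC.continuous.tendsto t₀).comp htt) ?_
    refine (hlim.comp hφ.tendsto_atTop).congr fun n => ?_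
    simp [htx]
  refine ⟨t₀, φ, fun n => (t (φ n) - t₀)⁻¹, hp, hφ, ?_⟩
  have hslope := hasDerivAt_iff_tendsto_slope.1
    ((hC.differentiable one_ne_zero) t₀).hasDerivAt
  have htne : Tendsto (t ∘ φ) atTop (𝓝[≠] t₀) := by
    refine tendsto_nhdsWithin_iff.2 ⟨htt, Eventually.of_forall fun n h => hne (φ n) ?_⟩
    have h' : t (φ n) = t₀ := h
    rw [← htx, h', hp]
  refine (hslope.comp htne).congr fun n => ?_
  simp [slope, htx, hp]

/-- Limits of rescalings of a common sequence of plane vectors have vanishing determinant. -/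
theorem det_eq_zero_of_tendsto_smul {d : ℕ → Plane} {a b : ℕ → ℝ} {v w : Plane}
    (hv : Tendsto (fun n => a n • d n) atTop (𝓝 v))
    (hw : Tendsto (fun n => b n • d n) atTop (𝓝 w)) :
    v.1 * w.2 - v.2 * w.1 = 0 := by
  refine tendsto_nhds_unique ((hv.fst_nhds.mul hw.snd_nhds).sub
    (hv.snd_nhds.mul hw.fst_nhds)) (tendsto_const_nhds.congr fun n => ?_)
  simp only [Prod.smul_fst, Prod.smul_snd, smul_eq_mul]
  ring

theorem projLine_mk_eq_of_det_eq_zero {v w : Plane} (hv : v ≠ 0) (hw : w ≠ 0)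
    (h : v.1 * w.2 - v.2 * w.1 = 0) :
    Projectivization.mk ℝ v hv = Projectivization.mk ℝ w hw := by
  rw [Projectivization.mk_eq_mk_iff']
  by_cases h1 : w.1 = 0
  · have h2 : w.2 ≠ 0 := fun h2 => hw (Prod.ext h1 h2)
    refine ⟨v.2 / w.2, Prod.ext ?_ ?_⟩
    · simp only [Prod.smul_fst, smul_eq_mul]
      field_simp
      linarith
    · simp [h2]
  · refine ⟨v.1 / w.1, Prod.ext ?_ ?_⟩
    · simp [h1]
    · simp only [Prod.smul_snd, smul_eq_mul]
      field_simp
      linarith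

/-- If two simple closed C¹ curves intersect in infinitely many distinct points
converging to `p`, then `p` lies on both curves and they have the same tangent
line at `p`. -/
theorem accumulating_intersections_same_tangent (Γ₁ Γ₂ : Set Plane)
    (h₁ : IsC1Curve Γ₁) (h₂ : IsC1Curve Γ₂)
    (x : ℕ → Plane) (hx : ∀ n, x n ∈ Γ₁ ∩ Γ₂)
    (hdist : ∀ m n, m ≠ n → x m ≠ x n)
    (p : Plane) (hlim : Tendsto x atTop (𝓝 p)) :
    p ∈ Γ₁ ∩ Γ₂ ∧ ∃ ℓ : ProjLine, TangentAt Γ₁ p ℓ ∧ TangentAt Γ₂ p ℓ := by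
  obtain ⟨γ₁, hγ₁, rfl⟩ := h₁
  obtain ⟨γ₂, hγ₂, rfl⟩ := h₂
  obtain ⟨N, hN⟩ : ∃ N, ∀ n, x (n + N) ≠ p := by
    by_cases h : ∃ m, x m = p
    · obtain ⟨m, rfl⟩ := h
      exact ⟨m + 1, fun n => hdist _ _ (by omega)⟩
    · exact ⟨0, fun n hn => h ⟨_, hn⟩⟩
  obtain ⟨t, φ, a, ht, hφ, ha⟩ := hγ₁.exists_subseq_secant_tendsto
    (x := fun n => x (n + N)) (fun n => (hx _).1) hN (hlim.comp (tendsto_add_atTop_nat N))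
  obtain ⟨s, ψ, b, hs, hψ, hb⟩ := hγ₂.exists_subseq_secant_tendsto
    (x := fun n => x (φ n + N)) (fun n => (hx _).2) (fun n => hN _)
    (hlim.comp ((tendsto_add_atTop_nat N).comp hφ.tendsto_atTop))
  refine ⟨⟨⟨t, ht⟩, ⟨s, hs⟩⟩, _, ⟨γ₁, t, hγ₁, rfl, ht, rfl⟩, ⟨γ₂, s, hγ₂, rfl, hs, ?_⟩⟩
  exact projLine_mk_eq_of_det_eq_zero _ _
    (det_eq_zero_of_tendsto_smul (ha.comp hψ.tendsto_atTop) hb)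
end
end

section
/- Let h : ℝ/ℤ → ℝ/ℤ be a bijection of the additive circle AddCircle (1:ℝ) such that either (i) for all a, b, c, sbtw a b c implies sbtw (h a) (h b) (h c), or (ii) for all a, b, c, sbtw a b c implies sbtw (h c) (h b) (h a). Then h is a homeomorphism, i.e. both h and h⁻¹ are continuous. -/
open Filter Topology

noncomputable section

instance : Fact ((0:ℝ) < 1) := ⟨one_pos⟩

theorem AddCircle.cIoo_coe_coe {p : ℝ} [hp : Fact (0 < p)] {a b : ℝ} (hab : a ≤ b)
    (hba : b < a + p) :
    Set.cIoo (a : AddCircle p) (b : AddCircle p) = (↑) '' Set.Ioo a b := by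
  have hb : toIcoMod hp.out a b = b := (toIcoMod_eq_self hp.out).2 ⟨hab, hba⟩
  have key (x : ℝ) : sbtw (a : AddCircle p) (x : AddCircle p) (b : AddCircle p) ↔
      toIocMod hp.out a x < b := by
    rw [sbtw_iff_not_btw, btw_cyclic]
    have := QuotientAddGroup.btw_coe_iff (hp' := hp) (x₁ := a) (x₂ := b) (x₃ := x)
    rw [hb] at this
    exact (not_congr this).trans not_le
  ext x
  induction x using QuotientAddGroup.induction_on with | H x => ?_
  refine (key x).trans ⟨fun hx => ?_, ?_⟩
  · exact ⟨toIocMod hp.out a x, ⟨left_lt_toIocMod hp.out a x, hx⟩,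
      AddCircle.coe_equivIoc (p := p) (a := a) (y := (x : AddCircle p))⟩
  · rintro ⟨y, hy, hyx⟩
    refine (key x).1 ?_
    have h_eq : toIocMod hp.out a y = y :=
      (toIocMod_eq_self hp.out).2 ⟨hy.1, (hy.2.trans hba).le⟩
    have := (key y).2 (h_eq.trans_lt hy.2)
    rwa [hyx] at this

theorem AddCircle.isOpen_cIoo {p : ℝ} [hp : Fact (0 < p)] (a b : AddCircle p) :
    IsOpen (Set.cIoo a b) := by
  induction a using QuotientAddGroup.induction_on with | H a => ?_
  obtain ⟨b, hb, rfl⟩ : b ∈ ((↑) : ℝ → AddCircle p) '' Set.Ico a (a + p) := by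
    rw [AddCircle.coe_image_Ico_eq]; trivial
  have := AddCircle.cIoo_coe_coe hb.1 hb.2
  exact this ▸ QuotientAddGroup.isOpenMap_coe _ isOpen_Ioo

theorem AddCircle.isTopologicalBasis_cIoo {p : ℝ} [hp : Fact (0 < p)] :
    TopologicalSpace.IsTopologicalBasis {s : Set (AddCircle p) | ∃ a b, s = Set.cIoo a b} := by
  refine TopologicalSpace.isTopologicalBasis_of_isOpen_of_nhds ?_ fun x U hx hU => ?_
  · rintro _ ⟨a, b, rfl⟩
    exact AddCircle.isOpen_cIoo a b
  induction x using QuotientAddGroup.induction_on with | H x => ?_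
  obtain ⟨ε, hε, hεU⟩ := Metric.isOpen_iff.1 (hU.preimage (AddCircle.continuous_mk' p)) x hx
  rw [Real.ball_eq_Ioo] at hεU
  have hp0 := hp.out
  obtain ⟨δ, hδ, hδ'⟩ := exists_between (lt_min hε (half_pos hp0))
  obtain ⟨hδε, hδp⟩ := lt_min_iff.1 hδ'
  refine ⟨_, ⟨((x - δ : ℝ) : AddCircle p), ((x + δ : ℝ) : AddCircle p), rfl⟩, ?_⟩
  rw [AddCircle.cIoo_coe_coe (by linarith) (by linarith)]
  refine ⟨⟨x, ⟨by linarith, by linarith⟩, rfl⟩, ?_⟩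
  rintro _ ⟨y, hy, rfl⟩
  exact hεU ⟨by linarith [hy.1], by linarith [hy.2]⟩

theorem AddCircle.continuous_of_preimage_cIoo {p q : ℝ} [Fact (0 < p)] [Fact (0 < q)]
    {f : AddCircle p → AddCircle q}
    (hf : ∀ a b, ∃ c d, f ⁻¹' Set.cIoo a b = Set.cIoo c d) : Continuous f := by
  refine AddCircle.isTopologicalBasis_cIoo.continuous_iff.2 ?_
  rintro _ ⟨a, b, rfl⟩
  obtain ⟨c, d, hcd⟩ := hf a b
  exact hcd ▸ AddCircle.isOpen_cIoo c d

theorem sbtw_iff_of_forall_sbtw {α β : Type*} [CircularOrder α] [CircularOrder β] {f : α → β}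
    (h : ∀ a b c, sbtw a b c → sbtw (f a) (f b) (f c)) {a b c : α} :
    sbtw (f a) (f b) (f c) ↔ sbtw a b c := by
  refine ⟨fun hs => ?_, h a b c⟩
  by_contra hn
  have hba : btw c b a := btw_iff_not_sbtw.2 hn
  by_cases hab : btw a b c
  · rcases hab.antisymm hba with rfl | rfl | rfl
    · exact sbtw_irrefl_left hs
    · exact sbtw_irrefl_right hs
    · exact sbtw_irrefl_left_right hs
  · exact sbtw_asymm hs (h _ _ _ (sbtw_of_btw_not_btw hba hab))

/-- A bijection of the circle `ℝ/ℤ` preserving (or reversing) the strict cyclic order of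
every triple is a homeomorphism. -/
theorem circle_order_bijection_homeo (h : AddCircle (1:ℝ) ≃ AddCircle (1:ℝ))
    (hord : (∀ a b c : AddCircle (1:ℝ), sbtw a b c → sbtw (h a) (h b) (h c)) ∨
            (∀ a b c : AddCircle (1:ℝ), sbtw a b c → sbtw (h c) (h b) (h a))) :
    Continuous h ∧ Continuous h.symm := by
  rcases hord with hord | hord
  · have hiff {a b c : AddCircle (1:ℝ)} : sbtw (h a) (h b) (h c) ↔ sbtw a b c :=
      sbtw_iff_of_forall_sbtw hord
    refine ⟨AddCircle.continuous_of_preimage_cIoo fun a b => ⟨h.symm a, h.symm b, ?_⟩,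
      AddCircle.continuous_of_preimage_cIoo fun a b => ⟨h a, h b, ?_⟩⟩
    · ext x
      simpa using hiff (a := h.symm a) (b := x) (c := h.symm b)
    · ext x
      simpa using (hiff (a := a) (b := h.symm x) (c := b)).symm
  · have hiff {a b c : AddCircle (1:ℝ)} : sbtw (h c) (h b) (h a) ↔ sbtw a b c :=
      sbtw_iff_of_forall_sbtw (f := fun x => OrderDual.toDual (h x)) hord
    refine ⟨AddCircle.continuous_of_preimage_cIoo fun a b => ⟨h.symm b, h.symm a, ?_⟩,
      AddCircle.continuous_of_preimage_cIoo fun a b => ⟨h b, h a, ?_⟩⟩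
    · ext x
      simpa using hiff (a := h.symm b) (b := x) (c := h.symm a)
    · ext x
      simpa using (hiff (a := a) (b := h.symm x) (c := b)).symm
end
end
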